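/- arXiv:1307.3042 — 2 statements merged into one kernel-verified Lean document; each statement's English description precedes it below -/
import Mathlib

section
/- Let α > 1 and λ > 0. Let b₁, b₂, … be complex numbers with |b_k| ≤ |b_{k+1}|, |b_k| → ∞ as k → ∞, and Σ_{b_k ≠ 0} |b_k|^{−λ} < ∞. For r > 0 let n(r) denote the number of b_k, counted with repetition, with |b_k| ≤ r. Then there exist a positive constant d_α, depending only on α, and an ε-set E such that for all sufficiently large z with z ∉ E and |z| = r: Σ_{|b_k| < αr} 1/|z − b_k| < d_α (n(α²r)/r) (log r)^α log n(α²r), and |z − b_k| ≥ 4|b_k|^{1−λ} for all k. -/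
open Filter Set Topology Bornology MeasureTheory

noncomputable section

/-! ### The extended plane and the chordal metric

ℂ∞ is modelled as `Option ℂ`, with `none` denoting the point ∞. -/

/-- The chordal metric χ on the extended complex plane ℂ∞ (`none` = ∞). -/
def chordal : Option ℂ → Option ℂ → ℝ
  | Option.none, Option.none => 0
  | Option.none, Option.some w => 1 / Real.sqrt (1 + ‖w‖ ^ 2)
  | Option.some z, Option.none => 1 / Real.sqrt (1 + ‖z‖ ^ 2)
  | Option.some z, Option.some w =>
      ‖z - w‖ / Real.sqrt ((1 + ‖z‖ ^ 2) * (1 + ‖w‖ ^ 2))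

/-! ### Meromorphic functions in the plane -/

/-- `f` is meromorphic on the plane with pole set `P`: poles form a discrete closed set,
`f` is analytic off `P`, and `|f| → ∞` at each point of `P`. -/
def MeroPlane (f : ℂ → ℂ) (P : Set ℂ) : Prop :=
  (∀ K : Set ℂ, IsCompact K → (P ∩ K).Finite) ∧
  (∀ z ∉ P, AnalyticAt ℂ f z) ∧
  ∀ p ∈ P, Tendsto (fun z => ‖f z‖) (nhdsWithin p Pᶜ) atTop

/-- `f` coincides with a rational function away from its poles. -/
def RationalFn (f : ℂ → ℂ) (P : Set ℂ) : Prop :=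
  ∃ p q : Polynomial ℂ, q ≠ 0 ∧ ∀ z ∉ P, q.eval z ≠ 0 → f z = p.eval z / q.eval z

/-- `f` is a transcendental meromorphic function in the plane, with pole set `P`. -/
def TranscMeroPlane (f : ℂ → ℂ) (P : Set ℂ) : Prop :=
  MeroPlane f P ∧ ¬ RationalFn f P

/-- `f` has a pole of order `m` at `z₀`. -/
def PoleOrder (f : ℂ → ℂ) (z₀ : ℂ) (m : ℕ) : Prop :=
  0 < m ∧ ∃ g : ℂ → ℂ, AnalyticAt ℂ g z₀ ∧ g z₀ ≠ 0 ∧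
    ∀ᶠ z in nhdsWithin z₀ {z₀}ᶜ, f z = g z / (z - z₀) ^ m

/-- `f` has a zero of order `m` at `z₀`. -/
def ZeroOrder (f : ℂ → ℂ) (z₀ : ℂ) (m : ℕ) : Prop :=
  0 < m ∧ ∃ g : ℂ → ℂ, AnalyticAt ℂ g z₀ ∧ g z₀ ≠ 0 ∧
    ∀ᶠ z in nhds z₀, f z = (z - z₀) ^ m * g z

/-- `z₀` is a multiple point of `f` of multiplicity `μ`: either a pole of `f` of order `μ ≥ 2`,
or a point of analyticity where `f'` has a zero of order `μ - 1`. -/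
def MultiplePointWithMult (f : ℂ → ℂ) (z₀ : ℂ) (μ : ℕ) : Prop :=
  2 ≤ μ ∧ (PoleOrder f z₀ μ ∨ (AnalyticAt ℂ f z₀ ∧ ZeroOrder (deriv f) z₀ (μ - 1)))

/-- `z₀` is a multiple point of `f`. -/
def MultiplePoint (f : ℂ → ℂ) (z₀ : ℂ) : Prop :=
  ∃ μ, MultiplePointWithMult f z₀ μ

open scoped Classical in
/-- The value of `f` at `z` as an element of ℂ∞, given the pole set `P`. -/
def valueAt (f : ℂ → ℂ) (P : Set ℂ) (z : ℂ) : Option ℂ :=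
  if z ∈ P then none else some (f z)

/-- The set of critical values of `f` in ℂ∞ (values at multiple points). -/
def CriticalValues (f : ℂ → ℂ) (P : Set ℂ) : Set (Option ℂ) :=
  {w | ∃ z, MultiplePoint f z ∧ w = valueAt f P z}

/-! ### Transcendental singularities of the inverse function -/

/-- A path tending to infinity on which `f → a`; such a path determines a transcendental
singularity of `f⁻¹` over `a`. -/
def AsymptoticPath (f : ℂ → ℂ) (P : Set ℂ) (a : Option ℂ) (γ : ℝ → ℂ) : Prop :=
  ContinuousOn γ (Ici 0) ∧
  Tendsto (fun t => ‖γ t‖) atTop atTop ∧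
  Tendsto (fun t => chordal (valueAt f P (γ t)) a) atTop (nhds 0)

/-- `C` is a connected component of the set `S`. -/
def IsComponentOf (C S : Set ℂ) : Prop :=
  ∃ x ∈ S, C = connectedComponentIn S x

/-- The paths `γ₁`, `γ₂`, with asymptotic values `a₁`, `a₂` respectively, determine
distinct transcendental singularities of `f⁻¹`. -/
def DistinctSingularities (f : ℂ → ℂ) (P : Set ℂ) (a₁ a₂ : Option ℂ) (γ₁ γ₂ : ℝ → ℂ) : Prop :=
  a₁ ≠ a₂ ∨ ∃ t : ℝ, 0 < t ∧ ∃ C₁ C₂ : Set ℂ,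
    IsComponentOf C₁ {z | chordal (valueAt f P z) a₁ < t} ∧
    IsComponentOf C₂ {z | chordal (valueAt f P z) a₂ < t} ∧
    Disjoint C₁ C₂ ∧
    IsBounded (γ₁ '' Ici 0 \ C₁) ∧ IsBounded (γ₂ '' Ici 0 \ C₂)

/-- The inverse function of `f` has finitely many transcendental singularities: there is a
bound `n` on the size of any family of pairwise distinct transcendental singularities. -/
def FinitelyManyTranscSing (f : ℂ → ℂ) (P : Set ℂ) : Prop :=
  ∃ n : ℕ, ∀ m : ℕ, ∀ a : Fin m → Option ℂ, ∀ γ : Fin m → ℝ → ℂ,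
    (∀ i, AsymptoticPath f P (a i) (γ i)) →
    (∀ i j, i ≠ j → DistinctSingularities f P (a i) (a j) (γ i) (γ j)) →
    m ≤ n

/-- The Schwarzian derivative `S_f = f'''/f' - (3/2)(f''/f')²`. -/
def schwarzian (f : ℂ → ℂ) (z : ℂ) : ℂ :=
  deriv (deriv (deriv f)) z / deriv f z - (3 / 2) * (deriv (deriv f) z / deriv f z) ^ 2

/-- `w` is a singular value of `f⁻¹`: a critical value or an asymptotic value of `f`. -/
def SingularValue (f : ℂ → ℂ) (P : Set ℂ) (w : Option ℂ) : Prop :=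
  w ∈ CriticalValues f P ∨ ∃ γ : ℝ → ℂ, AsymptoticPath f P w γ

/-! ### Nevanlinna theory -/

open scoped Classical in
/-- The order of the pole of `f` at `z` (junk value `0` if there is no pole). -/
def poleOrderAt (f : ℂ → ℂ) (z : ℂ) : ℕ :=
  if h : ∃ m, PoleOrder f z m then h.choose else 0

/-- `n(t, f)`: the number of poles of `f` of modulus at most `t`, counted with multiplicity. -/
def nCount (f : ℂ → ℂ) (t : ℝ) : ℕ :=
  ∑ᶠ z ∈ {w : ℂ | ‖w‖ ≤ t}, poleOrderAt f z

/-- `N(r, f)`: the integrated counting function of the poles of `f`. -/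
def nevN (f : ℂ → ℂ) (r : ℝ) : ℝ :=
  (nCount f 0 : ℝ) * Real.log r + ∫ t in (0:ℝ)..r, ((nCount f t : ℝ) - (nCount f 0 : ℝ)) / t

/-- `m(r, f)`: the Nevanlinna proximity function. -/
def nevm (f : ℂ → ℂ) (r : ℝ) : ℝ :=
  (1 / (2 * Real.pi)) * ∫ θ in (0:ℝ)..(2 * Real.pi),
    Real.log (max 1 (‖f (r * Complex.exp (θ * Complex.I))‖))

/-- `T(r, f)`: the Nevanlinna characteristic. -/
def nevT (f : ℂ → ℂ) (r : ℝ) : ℝ := nevm f r + nevN f r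

/-- The order of growth `ρ(f) = limsup_{r→∞} log T(r,f)/log r`, as an extended real. -/
def growthOrder (f : ℂ → ℂ) : EReal :=
  Filter.limsup (fun r : ℝ => ((Real.log (nevT f r) / Real.log r : ℝ) : EReal)) atTop

/-- ∞ is a Borel exceptional value of `f`. -/
def BorelExceptionalInfty (f : ℂ → ℂ) : Prop :=
  Filter.limsup (fun r : ℝ => ((Real.log (nevN f r) / Real.log r : ℝ) : EReal)) atTop <
  Filter.limsup (fun r : ℝ => ((Real.log (nevT f r) / Real.log r : ℝ) : EReal)) atTop

/-! ### Meromorphic functions near infinity and the Wiman-Valiron property -/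

/-- `A` is meromorphic in `R ≤ |z| < ∞` with pole set `P`. -/
def MeroAnnulus (A : ℂ → ℂ) (R : ℝ) (P : Set ℂ) : Prop :=
  P ⊆ {z : ℂ | R ≤ ‖z‖} ∧
  (∀ K : Set ℂ, IsCompact K → (P ∩ K).Finite) ∧
  (∀ z : ℂ, R < ‖z‖ → z ∉ P → AnalyticAt ℂ A z) ∧
  ∀ p ∈ P, Tendsto (fun z => ‖A z‖) (nhdsWithin p Pᶜ) atTop

/-- `A` (meromorphic near ∞ with pole set `P`) has an essential singularity at infinity:
it is not the case that the poles are bounded and `A(z) ~ c zⁿ` as `z → ∞`. -/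
def EssSingAtInfty (A : ℂ → ℂ) (P : Set ℂ) : Prop :=
  ¬ (IsBounded P ∧ ∃ (n : ℤ) (c : ℂ), c ≠ 0 ∧
      Tendsto (fun z : ℂ => A z / z ^ n)
        (Filter.comap (fun z : ℂ => ‖z‖) atTop ⊓ Filter.principal Pᶜ) (nhds c))

/-- The logarithmic rectangle `D(z_r, L)` of Definition 2.1. -/
def WVDisk (z₀ : ℂ) (Nr phir L : ℝ) : Set ℂ :=
  {z : ℂ | ∃ τ : ℂ, z = z₀ * Complex.exp τ ∧
    |τ.re| ≤ L * phir / Nr ∧ |τ.im| ≤ L * phir / Nr}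

/-- Data witnessing the Wiman-Valiron property for `A`, meromorphic in `R ≤ |z| < ∞`:
an unbounded set `F1 ⊆ [R,∞)`, functions `N : F1 → [2,∞)`, `phi : F1 → [1,∞)` and points
`zr r` with `|zr r| = r`, such that `N(r) → ∞`, `phi(r)/N(r) → 0`, `phi(r)/log N(r) → ∞`,
`phi(r) = o(log⁺ |A(zr r)|)`, and `A(z) ~ (z/zr r)^{N(r)} A(zr r)` on `D(zr r, 8)`,
uniformly as `r → ∞` in `F1`.  (For `z = zr r · e^τ` one has `(z/zr r)^{N(r)} = e^{N(r)τ}`.) -/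
structure WVData (A : ℂ → ℂ) (R : ℝ) where
  F1 : Set ℝ
  N : ℝ → ℝ
  phi : ℝ → ℝ
  zr : ℝ → ℂ
  F1_sub : F1 ⊆ Ici R
  F1_unbounded : ∀ c : ℝ, ∃ r ∈ F1, c < r
  N_ge : ∀ r ∈ F1, 2 ≤ N r
  phi_ge : ∀ r ∈ F1, 1 ≤ phi r
  N_tendsto : Tendsto N (atTop ⊓ Filter.principal F1) atTop
  phi_over_N : Tendsto (fun r => phi r / N r) (atTop ⊓ Filter.principal F1) (nhds 0)
  phi_over_logN : Tendsto (fun r => phi r / Real.log (N r)) (atTop ⊓ Filter.principal F1) atTop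
  zr_abs : ∀ r ∈ F1, ‖zr r‖ = r
  phi_small : Tendsto (fun r => phi r / Real.log (max 1 (‖A (zr r)‖)))
      (atTop ⊓ Filter.principal F1) (nhds 0)
  approx : ∀ ε : ℝ, 0 < ε → ∀ᶠ r in atTop ⊓ Filter.principal F1, ∀ τ : ℂ,
      |τ.re| ≤ 8 * phi r / N r → |τ.im| ≤ 8 * phi r / N r →
      ‖A (zr r * Complex.exp τ) - Complex.exp ((N r : ℂ) * τ) * A (zr r)‖
        ≤ ε * ‖Complex.exp ((N r : ℂ) * τ) * A (zr r)‖

/-- `A` has the Wiman-Valiron property (Definition 2.1). -/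
def HasWVProp (A : ℂ → ℂ) (R : ℝ) : Prop := Nonempty (WVData A R)

/-- The point `w_r = z_r exp(-4 phi(r)/N(r))`. -/
def WVwr {A : ℂ → ℂ} {R : ℝ} (W : WVData A R) (r : ℝ) : ℂ :=
  W.zr r * Complex.exp (((-(4 * W.phi r / W.N r) : ℝ) : ℂ))

/-- The quantity `Z_r = |2 z_r A(z_r)^{1/2} / (N(r)+2)|`. -/
def WVZr {A : ℂ → ℂ} {R : ℝ} (W : WVData A R) (r : ℝ) : ℝ :=
  2 * r * Real.sqrt (‖A (W.zr r)‖) / (W.N r + 2)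

/-- The data of an analytic branch `sqA r` of `A^{1/2}` on `D(z_r, 4)` together with the
primitive `Z r` of `A^{1/2}` with `Z r (w_r) = 2 w_r A(w_r)^{1/2}/(N+2)`; this encodes
`Z(z) = 2 w_r A(w_r)^{1/2}/(N+2) + ∫_{w_r}^z A(t)^{1/2} dt`. -/
def IsZData {A : ℂ → ℂ} {R : ℝ} (W : WVData A R) (sqA Z : ℝ → ℂ → ℂ) (r : ℝ) : Prop :=
  (∀ z ∈ WVDisk (W.zr r) (W.N r) (W.phi r) 4,
      (sqA r z) ^ 2 = A z ∧ AnalyticAt ℂ (sqA r) z ∧ HasDerivAt (Z r) (sqA r z) z) ∧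
  Z r (WVwr W r) = 2 * WVwr W r * sqA r (WVwr W r) / ((W.N r : ℂ) + 2)

/-- The closed logarithmic rectangle `J₁ = {Z : |log|Z/Z_r|| ≤ phi(r), |arg Z| ≤ π/4}`. -/
def J1 (Zr phir : ℝ) : Set ℂ :=
  {w : ℂ | w ≠ 0 ∧ |Real.log (‖w‖ / Zr)| ≤ phir ∧ |Complex.arg w| ≤ Real.pi / 4}

/-! ### ε-sets -/

/-- An ε-set: a countable union of discs `B(b_j, ρ_j)` with `|b_j| → ∞` and
`Σ ρ_j/|b_j| < ∞`. -/
def IsEpsilonSet (E : Set ℂ) : Prop :=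
  ∃ (b : ℕ → ℂ) (ρ : ℕ → ℝ), (∀ j, 0 ≤ ρ j) ∧
    Tendsto (fun j => ‖b j‖) atTop atTop ∧
    Summable (fun j => ρ j / ‖b j‖) ∧
    E = ⋃ j, Metric.ball (b j) (ρ j)


theorem es_sum_aux (b : ℕ → ℝ) (c : ℝ) (hc : 0 < c) : ∀ (n : ℕ) (s : Finset ℕ), s.card = n →
    (∀ k : ℕ, 1 ≤ k → k ≤ n → (s.filter (fun j => b j ≤ k * c)).card < k) →
    ∑ j ∈ s, 1 / b j ≤ (1 / c) * (harmonic n : ℝ) := by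
  intro n
  induction n with
  | zero =>
    intro s hs _
    rw [Finset.card_eq_zero] at hs
    simp [hs]
  | succ n ih =>
    intro s hs h
    have h1 := h (n + 1) (by omega) le_rfl
    have : ∃ j ∈ s, ((n + 1 : ℕ) : ℝ) * c < b j := by
      by_contra! hcon
      rw [Finset.filter_true_of_mem hcon] at h1
      omega
    obtain ⟨j, hj, hbj⟩ := this
    have h2 := ih (s.erase j) (by rw [Finset.card_erase_of_mem hj]; omega) (by
      intro k hk hkn
      refine lt_of_le_of_lt (Finset.card_le_card ?_) (h k hk (by omega))
      exact Finset.filter_subset_filter _ (Finset.erase_subset _ _))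
    rw [← Finset.add_sum_erase _ _ hj, harmonic_succ]
    push_cast
    push_cast at hbj
    have h3 : 1 / b j ≤ 1 / (((n : ℝ) + 1) * c) :=
      one_div_le_one_div_of_le (by positivity) hbj.le
    have h4 : 1 / (((n : ℝ) + 1) * c) = 1 / c * ((n : ℝ) + 1)⁻¹ := by
      field_simp
    rw [mul_add]
    linarith

theorem es_cartan (b : ℕ → ℂ) (s : Finset ℕ) (H : ℝ) (hH : 0 < H) (A : Set ℂ) :
    ∃ (u : Finset ℂ) (ρ : ℂ → ℝ), (∀ x ∈ u, x ∈ A) ∧ (∀ x ∈ u, 0 ≤ ρ x) ∧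
      ∑ x ∈ u, ρ x ≤ 6 * H ∧
      ∀ z ∈ A, (∀ x ∈ u, z ∉ Metric.ball x (ρ x)) →
        ∑ j ∈ s, 1 / ‖z - b j‖ ≤ (s.card / H) * (1 + Real.log s.card) := by
  classical
  rcases Nat.eq_zero_or_pos s.card with h0 | hpos
  · rw [Finset.card_eq_zero] at h0
    subst h0
    exact ⟨∅, fun _ => 0, by simp, by simp, by simp; positivity, by simp⟩
  set n := s.card with hn
  have hnR : (0 : ℝ) < n := by exact_mod_cast hpos
  set c : ℝ := H / n with hcdef
  have hc : 0 < c := by positivity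
  let F : ℂ → ℕ → Finset ℕ := fun z k => s.filter (fun j => ‖z - b j‖ ≤ k * c)
  let bad : Set ℂ := {z | z ∈ A ∧ ∃ k : ℕ, 1 ≤ k ∧ k ≤ n ∧ k ≤ (F z k).card}
  have hex : ∀ z : ℂ, ∃ k : ℕ, z ∈ bad → 1 ≤ k ∧ k ≤ n ∧ k ≤ (F z k).card := by
    intro z
    by_cases hz : z ∈ bad
    · obtain ⟨k, hk⟩ := hz.2
      exact ⟨k, fun _ => hk⟩
    · exact ⟨0, fun h => absurd h hz⟩
  choose K hK using hex
  obtain ⟨u, hu, hdis, hcov⟩ := Vitali.exists_disjoint_subfamily_covering_enlargement_closedBall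
    bad (fun z => z) (fun z => (K z : ℝ) * c) H (by
      intro z hz
      have h1 : (K z : ℝ) ≤ n := by exact_mod_cast (hK z hz).2.1
      calc (K z : ℝ) * c ≤ n * c := by gcongr
        _ = H := by rw [hcdef]; field_simp) 5 (by norm_num)
  have hsum : ∀ v : Finset ℂ, (v : Set ℂ) ⊆ u → ∑ z ∈ v, K z ≤ n := by
    intro v hv
    calc ∑ z ∈ v, K z ≤ ∑ z ∈ v, (F z (K z)).card :=
          Finset.sum_le_sum fun z hz => (hK z (hu (hv hz))).2.2
      _ = (v.biUnion fun z => F z (K z)).card := by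
          rw [Finset.card_biUnion]
          intro x hx y hy hxy
          rw [Function.onFun, Finset.disjoint_left]
          intro j hj1 hj2
          have hd := hdis (hv hx) (hv hy) hxy
          simp only [F, Finset.mem_filter] at hj1 hj2
          rw [Function.onFun, Set.disjoint_left] at hd
          refine @hd (b j) ?_ ?_
          · rw [Metric.mem_closedBall', dist_eq_norm]; exact hj1.2
          · rw [Metric.mem_closedBall', dist_eq_norm]; exact hj2.2
      _ ≤ n := Finset.card_le_card (by
          intro j hj
          simp only [F, Finset.mem_biUnion, Finset.mem_filter] at hj
          obtain ⟨_, _, h, _⟩ := hj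
          exact h)
  have hcard : ∀ v : Finset ℂ, (v : Set ℂ) ⊆ u → v.card ≤ n := by
    intro v hv
    refine le_trans ?_ (hsum v hv)
    rw [Finset.card_eq_sum_ones]
    exact Finset.sum_le_sum fun z hz => (hK z (hu (hv hz))).1
  have hfin : u.Finite := by
    by_contra hinf
    obtain ⟨v, hv, hvc⟩ := Set.Infinite.exists_subset_card_eq hinf (n + 1)
    have := hcard v hv
    omega
  refine ⟨hfin.toFinset, fun z => 6 * ((K z : ℝ) * c), ?_, ?_, ?_, ?_⟩
  · intro x hx
    exact (hu (hfin.mem_toFinset.1 hx)).1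
  · intro x _
    positivity
  · rw [← Finset.mul_sum, ← Finset.sum_mul]
    have h1 : (∑ z ∈ hfin.toFinset, (K z : ℝ)) ≤ n := by
      exact_mod_cast hsum hfin.toFinset (by simp)
    have h2 : (∑ z ∈ hfin.toFinset, (K z : ℝ)) * c ≤ H := by
      calc _ ≤ (n : ℝ) * c := by gcongr
        _ = H := by rw [hcdef]; field_simp
    linarith
  · intro z hzA hz
    have hnb : z ∉ bad := by
      intro hzb
      obtain ⟨x, hx, hsub⟩ := hcov z hzb
      refine hz x (hfin.mem_toFinset.2 hx) ?_
      have hr : 0 < (K x : ℝ) * c := by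
        have : (1 : ℝ) ≤ K x := by exact_mod_cast (hK x (hu hx)).1
        positivity
      have := hsub (Metric.mem_closedBall_self (by positivity))
      rw [Metric.mem_closedBall] at this
      rw [Metric.mem_ball]
      linarith
    have h1 := es_sum_aux (fun j => ‖z - b j‖) c hc n s hn.symm (by
      intro k hk hkn
      by_contra! hcon
      exact hnb ⟨hzA, k, hk, hkn, hcon⟩)
    refine h1.trans ?_
    have h2 := harmonic_le_one_add_log n
    have h3 : 1 / c = n / H := by rw [hcdef]; field_simp
    rw [h3]
    gcongr

theorem es_isEps {ι : Type} [Countable ι] [Infinite ι] (c : ι → ℂ) (ρ : ι → ℝ)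
    (h0 : ∀ i, 0 ≤ ρ i) (ht : Tendsto (fun i => ‖c i‖) cofinite atTop)
    (hs : Summable (fun i => ρ i / ‖c i‖)) : IsEpsilonSet (⋃ i, Metric.ball (c i) (ρ i)) := by
  obtain ⟨_⟩ := nonempty_denumerable ι
  let e : ℕ ≃ ι := (Denumerable.eqv ι).symm
  refine ⟨c ∘ e, ρ ∘ e, fun j => h0 _, ?_, ?_, ?_⟩
  · rw [← Nat.cofinite_eq_atTop]
    exact ht.comp e.injective.tendsto_cofinite
  · exact hs.comp_injective e.injective
  · exact (e.surjective.iUnion_comp (fun i => Metric.ball (c i) (ρ i))).symm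

theorem es_sigma_summable (u : ℕ → Finset ℂ) (ρ : ℕ → ℂ → ℝ) (hρ0 : ∀ m, ∀ x ∈ u m, 0 ≤ ρ m x)
    (g : ℕ → ℝ) (hg : Summable g) (hle : ∀ m, ∑ x ∈ u m, ρ m x / ‖x‖ ≤ g m) :
    Summable (fun p : (Σ m, {x // x ∈ u m}) => ρ p.1 p.2.1 / ‖p.2.1‖) := by
  rw [summable_sigma_of_nonneg]
  · refine ⟨fun m => (hasSum_fintype _).summable, ?_⟩
    refine Summable.of_nonneg_of_le ?_ ?_ hg
    · intro m
      exact tsum_nonneg fun x => div_nonneg (hρ0 m x.1 x.2) (norm_nonneg _)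
    · intro m
      rw [tsum_fintype]
      refine le_trans (le_of_eq ?_) (hle m)
      exact Finset.sum_coe_sort (u m) (fun x => ρ m x / ‖x‖)
  · rintro ⟨m, x⟩
    exact div_nonneg (hρ0 m x.1 x.2) (norm_nonneg _)

set_option maxHeartbeats 1000000 in
/-- Lemma 7.1: given `α > 1` there is `d_α > 0` such that for any `λ > 0` and
any sequence `(b_k)` with increasing moduli tending to ∞ and `Σ |b_k|^{-λ} < ∞`, there is an
ε-set `E` outside which, for large `z`, the stated sum estimate holds and
`|z - b_k| ≥ 4 |b_k|^{1-λ}` for all `k`. -/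
theorem epsilon_set_sum_estimate
    (α : ℝ) (hα : 1 < α) :
    ∃ d : ℝ, 0 < d ∧
    ∀ lam : ℝ, 0 < lam →
    ∀ b : ℕ → ℂ,
      (∀ k, ‖b k‖ ≤ ‖b (k + 1)‖) →
      Tendsto (fun k => ‖b k‖) atTop atTop →
      Summable (fun k => if b k = 0 then (0 : ℝ) else ‖b k‖ ^ (-lam)) →
      ∃ E : Set ℂ, IsEpsilonSet E ∧ ∃ r₀ : ℝ, ∀ z : ℂ, z ∉ E → r₀ ≤ ‖z‖ →
        ((∑ᶠ k ∈ {k : ℕ | ‖b k‖ < α * ‖z‖},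
            1 / ‖z - b k‖)
          < d * ((Set.ncard {k : ℕ | ‖b k‖ ≤ α ^ 2 * ‖z‖} : ℝ)
                / ‖z‖)
              * Real.log (‖z‖) ^ α
              * Real.log (Set.ncard {k : ℕ | ‖b k‖ ≤ α ^ 2 * ‖z‖} : ℝ)) ∧
        ∀ k, 4 * ‖b k‖ ^ (1 - lam) ≤ ‖z - b k‖ := by
  have hα0 : 0 < α := by linarith
  have hlogα : 0 < Real.log α := Real.log_pos hα
  refine ⟨2 * (α * (2 / Real.log α) ^ α * 2), by positivity, ?_⟩
  intro lam hlam b hmono hb hsum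
  have hmon : Monotone (fun k => ‖b k‖) := monotone_nat_of_le_succ hmono
  have hfinset : ∀ R : ℝ, {k : ℕ | ‖b k‖ ≤ R}.Finite := by
    intro R
    rw [← Nat.cofinite_eq_atTop] at hb
    have := hb.eventually (eventually_gt_atTop R)
    rw [Filter.eventually_cofinite] at this
    simpa using this
  let S : ℕ → Finset ℕ := fun m => (hfinset (α ^ (m + 2))).toFinset
  let Hm : ℕ → ℝ := fun m => α ^ m / ((m : ℝ) + 1) ^ α
  have hHm : ∀ m, 0 < Hm m := fun m => by positivity
  let A : ℕ → Set ℂ := fun m => {z | α ^ m ≤ ‖z‖ ∧ ‖z‖ < α ^ (m + 1)}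
  choose u ρ huA hρ0 hρsum hgood using fun m => es_cartan b (S m) (Hm m) (hHm m) (A m)
  let ι := ℕ ⊕ (Σ m, {x // x ∈ u m})
  let c : ι → ℂ := Sum.elim b (fun p => p.2.1)
  let R : ι → ℝ := Sum.elim (fun k => if b k = 0 then 0 else 4 * ‖b k‖ ^ (1 - lam))
    (fun p => ρ p.1 p.2.1)
  refine ⟨⋃ i, Metric.ball (c i) (R i), es_isEps c R ?_ ?_ ?_, max α (max 4 ‖b 2‖), ?_⟩
  · rintro (k | ⟨m, x⟩)
    · simp only [R, Sum.elim_inl]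
      split_ifs
      · exact le_rfl
      · positivity
    · exact hρ0 m x.1 x.2
  · rw [tendsto_atTop]
    intro M
    rw [Filter.eventually_cofinite]
    obtain ⟨N, hN⟩ := pow_unbounded_of_one_lt M hα
    have hf1 : {k : ℕ | ‖b k‖ ≤ M}.Finite := hfinset M
    have hf2 : (⋃ m ∈ Set.Iio N, Set.range (fun x : {x // x ∈ u m} =>
        (Sum.inr ⟨m, x⟩ : ι))).Finite :=
      (Set.finite_Iio N).biUnion fun m _ => Set.finite_range _
    refine ((hf1.image (fun k => (Sum.inl k : ι))).union hf2).subset ?_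
    rintro (k | ⟨m, x⟩) hi
    · left
      have hi' : ¬ M ≤ ‖b k‖ := hi
      exact Set.mem_image_of_mem _ (show ‖b k‖ ≤ M from (not_le.1 hi').le)
    · right
      have hi' : ¬ M ≤ ‖x.1‖ := hi
      rw [not_le] at hi'
      simp only [Set.mem_iUnion]
      refine ⟨m, ?_, x, rfl⟩
      have h1 := (huA m x.1 x.2).1
      by_contra hcon
      have h2 : α ^ N ≤ α ^ m := pow_le_pow_right₀ hα.le (by simpa using hcon)
      linarith
  · refine Summable.sum (f := fun i => R i / ‖c i‖) ?_ ?_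
    · refine (hsum.mul_left 4).congr ?_
      intro k
      simp only [R, c, Function.comp, Sum.elim_inl]
      split_ifs with h
      · simp
      · have hp : 0 < ‖b k‖ := norm_pos_iff.2 h
        rw [sub_eq_add_neg, Real.rpow_add hp, Real.rpow_one]
        field_simp
    · refine es_sigma_summable u ρ hρ0 (fun m : ℕ => 6 * (1 / ((m : ℝ) + 1) ^ α)) ?_ ?_
      · refine Summable.mul_left 6 ?_
        have := (summable_nat_add_iff 1).2 (Real.summable_one_div_nat_rpow.2 hα)
        simpa using this
      · intro m
        calc ∑ x ∈ u m, ρ m x / ‖x‖ ≤ ∑ x ∈ u m, ρ m x / α ^ m := by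
              refine Finset.sum_le_sum fun x hx => ?_
              exact div_le_div_of_nonneg_left (hρ0 m x hx) (by positivity) (huA m x hx).1
          _ = (∑ x ∈ u m, ρ m x) / α ^ m := by rw [Finset.sum_div]
          _ ≤ 6 * Hm m / α ^ m := by gcongr; exact hρsum m
          _ = 6 * (1 / ((m : ℝ) + 1) ^ α) := by simp only [Hm]; field_simp
  intro z hz hr
  have hr1 : α ≤ ‖z‖ := (le_max_left _ _).trans hr
  have hr2 : 4 ≤ ‖z‖ := (le_max_left _ _).trans ((le_max_right _ _).trans hr)
  have hr3 : ‖b 2‖ ≤ ‖z‖ := (le_max_right _ _).trans ((le_max_right _ _).trans hr)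
  simp only [Set.mem_iUnion, not_exists] at hz
  constructor
  swap
  · intro k
    have hk := hz (Sum.inl k)
    simp only [c, R, Sum.elim_inl] at hk
    by_cases h : b k = 0
    · rw [h, norm_zero, sub_zero]
      have : (0 : ℝ) ^ (1 - lam) ≤ 1 := Real.zero_rpow_le_one _
      linarith
    · rw [if_neg h, Metric.mem_ball, dist_eq_norm, not_lt] at hk
      exact hk
  obtain ⟨m, hm1, hm2⟩ := exists_nat_pow_near (by linarith : 1 ≤ ‖z‖) hα
  have hg := hgood m z ⟨hm1, hm2⟩ (fun x hx => hz (Sum.inr ⟨m, ⟨x, hx⟩⟩))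
  set r := ‖z‖ with hrdef
  have hr0 : 0 < r := by linarith
  set n' := Set.ncard {k : ℕ | ‖b k‖ ≤ α ^ 2 * r} with hn'
  have hle : ((S m).card : ℝ) ≤ n' := by
    have : (S m).card ≤ n' := by
      rw [hn', ← Set.ncard_coe_finset]
      refine Set.ncard_le_ncard ?_ (hfinset _)
      intro k hk
      have hk' : ‖b k‖ ≤ α ^ (m + 2) := by simpa [S] using hk
      show ‖b k‖ ≤ α ^ 2 * r
      refine hk'.trans ?_
      rw [pow_add, mul_comm]
      gcongr
    exact_mod_cast this
  have hα2 : 1 ≤ α ^ 2 := one_le_pow₀ hα.le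
  have h3 : 3 ≤ n' := by
    have h4 : (((Finset.range 3 : Finset ℕ) : Set ℕ)).ncard ≤ n' := by
      refine Set.ncard_le_ncard ?_ (hfinset _)
      intro k hk
      have hk' : k ≤ 2 := by
        have : k < 3 := by simpa using hk
        omega
      have := hmon hk'
      show ‖b k‖ ≤ α ^ 2 * r
      simp only at this
      nlinarith
    rwa [Set.ncard_coe_finset, Finset.card_range] at h4
  have h3R : (3 : ℝ) ≤ n' := by exact_mod_cast h3
  have hlogn : 1 ≤ Real.log n' := by
    rw [Real.le_log_iff_exp_le (by linarith)]
    linarith [Real.exp_one_lt_d9]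
  have hlogr : 0 < Real.log r := Real.log_pos (by linarith)
  have hm0 : 1 ≤ m := by
    by_contra hcon
    have : m = 0 := by omega
    subst this
    simp at hm2
    linarith
  have hmlog : (m : ℝ) + 1 ≤ 2 / Real.log α * Real.log r := by
    have h5 : (m : ℝ) * Real.log α ≤ Real.log r := by
      rw [← Real.log_pow]
      exact Real.log_le_log (by positivity) hm1
    have h6 : (1 : ℝ) ≤ m := by exact_mod_cast hm0
    rw [div_mul_eq_mul_div, le_div_iff₀ hlogα]
    nlinarith
  have hpow : ((m : ℝ) + 1) ^ α ≤ (2 / Real.log α) ^ α * Real.log r ^ α := by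
    rw [← Real.mul_rpow (by positivity) hlogr.le]
    exact Real.rpow_le_rpow (by positivity) hmlog hα0.le
  have hHinv : 1 / Hm m ≤ α / r * ((2 / Real.log α) ^ α * Real.log r ^ α) := by
    have : 1 / Hm m = 1 / α ^ m * ((m : ℝ) + 1) ^ α := by
      simp only [Hm]; field_simp
    rw [this]
    have h7 : 1 / α ^ m ≤ α / r := by
      rw [div_le_div_iff₀ (by positivity) hr0, ← pow_succ']
      linarith
    gcongr
  have hlog1 : 1 + Real.log (S m).card ≤ 2 * Real.log n' := by
    have : Real.log (S m).card ≤ Real.log n' := by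
      rcases Nat.eq_zero_or_pos (S m).card with h | h
      · rw [h]; simp; linarith
      · exact Real.log_le_log (by exact_mod_cast h) hle
    linarith
  have hsumle : (∑ᶠ k ∈ {k : ℕ | ‖b k‖ < α * r}, 1 / ‖z - b k‖)
      ≤ ∑ j ∈ S m, 1 / ‖z - b j‖ := by
    have hf : {k : ℕ | ‖b k‖ < α * r}.Finite :=
      (hfinset (α * r)).subset fun k hk => show ‖b k‖ ≤ α * r from
        le_of_lt (show ‖b k‖ < α * r from hk)
    rw [finsum_mem_eq_finite_toFinset_sum _ hf]
    refine Finset.sum_le_sum_of_subset_of_nonneg ?_ (fun _ _ _ => by positivity)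
    intro k hk
    have hk' : ‖b k‖ < α * r := by simpa using hk
    have : ‖b k‖ ≤ α ^ (m + 2) := by
      have : α * r ≤ α * α ^ (m + 1) := by gcongr
      rw [← pow_succ'] at this
      linarith
    simpa [S] using this
  have hX : 0 < (n' / r) * (α * (2 / Real.log α) ^ α * 2) * Real.log r ^ α * Real.log n' := by
    have : (0 : ℝ) < n' := by linarith
    have : 0 < Real.log n' := by linarith
    positivity
  calc _ ≤ _ := hsumle
    _ ≤ _ := hg
    _ = (S m).card * (1 / Hm m) * (1 + Real.log (S m).card) := by ring
    _ ≤ n' * (α / r * ((2 / Real.log α) ^ α * Real.log r ^ α)) * (2 * Real.log n') := by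
        have : 0 ≤ 1 + Real.log (S m).card := by
          have := Real.log_natCast_nonneg (S m).card
          linarith
        have := (hHm m).le
        gcongr
    _ = (n' / r) * (α * (2 / Real.log α) ^ α * 2) * Real.log r ^ α * Real.log n' := by ring
    _ < 2 * ((n' / r) * (α * (2 / Real.log α) ^ α * 2) * Real.log r ^ α * Real.log n') := by
        linarith
    _ = _ := by ring

end
end

section
/- Let λ > 0 and let G be a transcendental meromorphic function in the plane with order of growth less than λ. Then there exists an ε-set E such that, as z → ∞ in ℂ \ E, uniformly for all ζ with |ζ − z| ≤ |z|^{1−λ}: G(ζ) ∼ G(z) (i.e. G(ζ)/G(z) → 1) and |log|G(ζ)|| = o(|z|^λ). -/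
open Filter Set Topology Bornology MeasureTheory

noncomputable section

lemma sv_sum_le (m : ℂ → ℕ) (val : ℂ → ℝ) (c : ℕ → ℝ) (hc : ∀ k l, 1 ≤ k → k ≤ l → c l ≤ c k) :
    ∀ F : Finset ℂ, (∀ F' ⊆ F, F'.Nonempty → ∃ a ∈ F', val a ≤ c (∑ b ∈ F', m b)) →
      ∑ a ∈ F, (m a : ℝ) * val a ≤ ∑ k ∈ Finset.Ioc 0 (∑ b ∈ F, m b), c k := by
  intro F
  induction F using Finset.strongInduction with
  | H F ih =>
    intro h
    rcases F.eq_empty_or_nonempty with rfl | hne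
    · simp
    obtain ⟨a, haF, ha⟩ := h F subset_rfl hne
    have h1 := ih (F.erase a) (Finset.erase_ssubset haF)
      (fun F' hF' => h F' (hF'.trans (Finset.erase_subset _ _)))
    rw [← Finset.add_sum_erase F _ haF]
    have hM : ∑ b ∈ F, m b = m a + ∑ b ∈ F.erase a, m b := (Finset.add_sum_erase F _ haF).symm
    set M' := ∑ b ∈ F.erase a, m b
    rw [hM] at ha ⊢
    have h2 : Finset.Ioc 0 (m a + M') = Finset.Ioc 0 M' ∪ Finset.Ioc M' (m a + M') := by
      ext x; simp
    rw [h2, Finset.sum_union (by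
      rw [Finset.disjoint_left]; intro x; simp; omega)]
    have h3 : (m a : ℝ) * val a ≤ ∑ k ∈ Finset.Ioc M' (m a + M'), c k := by
      calc (m a : ℝ) * val a ≤ m a * c (m a + M') := by gcongr
        _ = ∑ k ∈ Finset.Ioc M' (m a + M'), c (m a + M') := by simp
        _ ≤ _ := by
          apply Finset.sum_le_sum
          intro k hk
          simp at hk
          apply hc <;> omega
    linarith

lemma sv_harm (m : ℂ → ℕ) (d : ℂ → ℝ) (K : ℝ) (hK : 0 < K) (F : Finset ℂ) (hd : ∀ a ∈ F, 0 < d a)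
    (h : ∀ F' ⊆ F, ∀ a ∈ F', (∀ b ∈ F', d b ≤ d a) → ((∑ b ∈ F', m b : ℕ) : ℝ) ≤ K * d a)
    (hm : ∀ a ∈ F, 1 ≤ m a) :
    ∑ a ∈ F, (m a : ℝ) / d a ≤ K * (1 + Real.log (∑ b ∈ F, m b : ℕ)) := by
  have := sv_sum_le m (fun a => 1 / d a) (fun k => K * (k : ℝ)⁻¹) (by
    intro k l hk hl
    have : (0:ℝ) < k := by exact_mod_cast hk
    gcongr) F (by
    intro F' hF' hne
    obtain ⟨a, ha, hmax⟩ := F'.exists_max_image d hne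
    refine ⟨a, ha, ?_⟩
    have h1 := h F' hF' a ha hmax
    have hda := hd a (hF' ha)
    have hpos : (0:ℝ) < ((∑ b ∈ F', m b : ℕ) : ℝ) := by
      have : m a ≤ ∑ b ∈ F', m b := Finset.single_le_sum (f := m) (fun _ _ => Nat.zero_le _) ha
      have := hm a (hF' ha)
      exact_mod_cast (by omega : 0 < ∑ b ∈ F', m b)
    rw [← div_eq_mul_inv, div_le_div_iff₀ hda hpos]
    linarith)
  have h2 := harmonic_le_one_add_log (∑ b ∈ F, m b)
  rw [harmonic_eq_sum_Icc] at h2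
  push_cast at h2
  have h3 : Finset.Ioc 0 (∑ b ∈ F, m b) = Finset.Icc 1 (∑ b ∈ F, m b) := by ext; simp; omega
  rw [← Finset.mul_sum, h3] at this
  calc _ = ∑ a ∈ F, (m a : ℝ) * (1 / d a) := by simp [div_eq_mul_inv]
    _ ≤ _ := this
    _ ≤ _ := by push_cast; gcongr

lemma sv_summable (m : ℂ → ℕ) (s s' R0 : ℝ) (hs : 0 < s) (hss : s < s')
    (h0 : ∀ R ≥ R0, ∀ F : Finset ℂ, (∀ a ∈ F, ‖a‖ ≤ R) → ((∑ a ∈ F, m a : ℕ) : ℝ) ≤ R ^ s) :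
    Summable (fun a => (m a : ℝ) * ‖a‖ ^ (-s')) := by
  classical
  have hcs : Summable (fun k : ℕ => (k : ℝ) ^ (-(s' / s))) := by
    rw [Real.summable_nat_rpow]
    rw [neg_lt_neg_iff, one_lt_div hs]; exact hss
  -- the part outside the ball
  have h1 : ∀ F : Finset ℂ, (∀ a ∈ F, R0 ≤ ‖a‖ ∧ 1 ≤ m a) →
      ∑ a ∈ F, (m a : ℝ) * ‖a‖ ^ (-s') ≤ ∑' k : ℕ, (k : ℝ) ^ (-(s' / s)) := by
    intro F hF
    have := sv_sum_le m (fun a => ‖a‖ ^ (-s')) (fun k => (k : ℝ) ^ (-(s' / s))) (by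
      intro k l hk hl
      have : (0:ℝ) < k := by exact_mod_cast hk
      apply Real.rpow_le_rpow_of_nonpos this (by exact_mod_cast hl)
      have : 0 < s' / s := div_pos (by linarith) hs
      linarith) F (by
      intro F' hF' hne
      obtain ⟨a, ha, hmax⟩ := F'.exists_max_image (fun a => ‖a‖) hne
      refine ⟨a, ha, ?_⟩
      have h1 := h0 ‖a‖ (hF a (hF' ha)).1 F' hmax
      have hpos : (0:ℝ) < ((∑ b ∈ F', m b : ℕ) : ℝ) := by
        have : m a ≤ ∑ b ∈ F', m b := Finset.single_le_sum (f := m) (fun _ _ => Nat.zero_le _) ha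
        have := (hF a (hF' ha)).2
        exact_mod_cast (by omega : 0 < ∑ b ∈ F', m b)
      have h2 := Real.rpow_le_rpow_of_nonpos hpos h1 (z := -(s'/s)) (by
        have : 0 < s' / s := div_pos (by linarith) hs
        linarith)
      rwa [← Real.rpow_mul (norm_nonneg _), show s * -(s'/s) = -s' by field_simp] at h2)
    refine this.trans ?_
    exact hcs.sum_le_tsum _ (fun k _ => by positivity)
  have h2 : ∀ F : Finset ℂ, (∀ a ∈ F, ‖a‖ ≤ R0) → (∀ a ∈ F, 1 ≤ m a) → (F.card : ℝ) ≤ R0 ^ s := by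
    intro F hF hm
    refine le_trans ?_ (h0 R0 le_rfl F hF)
    exact_mod_cast (by simpa using Finset.card_nsmul_le_sum F m 1 hm)
  have hfin : {a : ℂ | ‖a‖ ≤ R0 ∧ 1 ≤ m a}.Finite := by
    by_contra hinf
    obtain ⟨F, hF, hc⟩ := Set.Infinite.exists_subset_card_eq hinf (⌈R0 ^ s⌉₊ + 1)
    have := h2 F (fun a ha => (hF ha).1) (fun a ha => (hF ha).2)
    rw [hc] at this
    push_cast at this
    linarith [Nat.le_ceil (R0 ^ s)]
  refine summable_of_sum_le (c := ∑ a ∈ hfin.toFinset, (m a : ℝ) * ‖a‖ ^ (-s') +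
    ∑' k : ℕ, (k : ℝ) ^ (-(s' / s))) (fun a => by positivity) ?_
  intro F
  have h3 : ∑ a ∈ F, (m a : ℝ) * ‖a‖ ^ (-s') =
      ∑ a ∈ F with 1 ≤ m a, (m a : ℝ) * ‖a‖ ^ (-s') := by
    symm
    apply Finset.sum_filter_of_ne
    intro a ha hne
    by_contra hlt
    apply hne
    simp [show m a = 0 by omega]
  rw [h3, ← Finset.sum_filter_add_sum_filter_not _ (fun a => ‖a‖ ≤ R0)]
  apply add_le_add
  · apply Finset.sum_le_sum_of_subset_of_nonneg
    · intro a; simp; tauto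
    · intros; positivity
  · apply h1
    intro a; simp; intro _ h h'; exact ⟨h'.le, h⟩

lemma sv_eps {ι : Type*} [Countable ι] (b : ι → ℂ) (ρ : ι → ℝ) (hρ : ∀ i, 0 ≤ ρ i)
    (hfin : ∀ R : ℝ, {i | ‖b i‖ ≤ R}.Finite) (hsum : Summable (fun i => ρ i / ‖b i‖)) :
    IsEpsilonSet (⋃ i, Metric.ball (b i) (ρ i)) := by
  classical
  obtain ⟨e, he⟩ := Countable.exists_injective_nat ι
  let b' : ℕ → ℂ := fun n => if h : ∃ i, e i = n then b h.choose else (n : ℂ)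
  let ρ' : ℕ → ℝ := fun n => if h : ∃ i, e i = n then ρ h.choose else 0
  have hch : ∀ i, (⟨i, rfl⟩ : ∃ j, e j = e i).choose = i := fun i =>
    he (⟨i, rfl⟩ : ∃ j, e j = e i).choose_spec
  have hb : ∀ i, b' (e i) = b i := by
    intro i
    have h : ∃ j, e j = e i := ⟨i, rfl⟩
    simp only [b', dif_pos h, hch]
  have hr : ∀ i, ρ' (e i) = ρ i := by
    intro i
    have h : ∃ j, e j = e i := ⟨i, rfl⟩
    simp only [ρ', dif_pos h, hch]
  have hb0 : ∀ n, n ∉ range e → b' n = n := fun n hn => dif_neg hn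
  have hr0 : ∀ n, n ∉ range e → ρ' n = 0 := fun n hn => dif_neg hn
  refine ⟨b', ρ', ?_, ?_, ?_, ?_⟩
  · intro n
    by_cases hn : n ∈ range e
    · obtain ⟨i, rfl⟩ := hn; rw [hr]; exact hρ i
    · rw [hr0 n hn]
  · rw [← Nat.cofinite_eq_atTop, tendsto_atTop]
    intro R
    have : ((e '' {i | ‖b i‖ ≤ R}) ∪ {n : ℕ | n ≤ ⌈R⌉₊}).Finite :=
      ((hfin R).image e).union (Set.finite_Iic _)
    refine this.subset ?_
    intro n hn
    have hn : ¬ (R ≤ ‖b' n‖) := hn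
    by_cases h : n ∈ range e
    · obtain ⟨i, rfl⟩ := h
      rw [hb] at hn
      exact Or.inl ⟨i, (not_le.1 hn).le, rfl⟩
    · rw [hb0 n h] at hn
      right
      have : (n : ℝ) ≤ ⌈R⌉₊ := by
        simp at hn
        exact hn.le.trans (Nat.le_ceil R)
      exact_mod_cast this
  · rw [← he.summable_iff]
    · simpa [Function.comp_def, hb, hr] using hsum
    · intro n hn; simp [hr0 n hn]
  · ext z
    simp only [mem_iUnion]
    constructor
    · rintro ⟨i, hi⟩; exact ⟨e i, by rwa [hb, hr]⟩
    · rintro ⟨n, hn⟩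
      by_cases h : n ∈ range e
      · obtain ⟨i, rfl⟩ := h
        rw [hb, hr] at hn; exact ⟨i, hn⟩
      · rw [hr0 n h] at hn; simp at hn

lemma sv_vitali (v : ℂ → ℝ) (hv : ∀ a, 0 ≤ v a) (hs : Summable v)
    (hfin : ∀ R : ℝ, {a | ‖a‖ ≤ R ∧ v a ≠ 0}.Finite) :
    ∃ E : Set ℂ, IsEpsilonSet E ∧ ∀ z ∉ E, ∀ t, 0 < t → t ≤ ‖z‖ / 2 → ∀ A : Finset ℂ,
      (∀ a ∈ A, ‖a - z‖ ≤ t) → ‖z‖ * ∑ a ∈ A, v a < t := by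
  classical
  let T : Set (ℂ × ℝ × Finset ℂ) := {p | 0 < p.2.1 ∧ p.2.1 ≤ ‖p.1‖ / 2 ∧
    (∀ a ∈ p.2.2, ‖a - p.1‖ ≤ p.2.1) ∧ p.2.1 ≤ ‖p.1‖ * ∑ a ∈ p.2.2, v a}
  obtain ⟨u, huT, hdisj, hcov⟩ := Vitali.exists_disjoint_subfamily_covering_enlargement
    (fun p : ℂ × ℝ × Finset ℂ => Metric.closedBall p.1 p.2.1) T (fun p => p.2.1 / ‖p.1‖) 2
    (by norm_num) (fun p hp => by have := hp.1; positivity) (1/2) (fun p hp => by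
      have h1 := hp.1
      have h2 := hp.2.1
      rw [div_le_iff₀ (by linarith)]; linarith)
    (fun p hp => ⟨p.1, by simpa using hp.1.le⟩)
  have hcount : u.Countable := hdisj.countable_of_nonempty_interior (fun p hp => by
    refine ⟨p.1, ?_⟩
    rw [interior_closedBall _ (huT hp).1.ne']
    simpa using (huT hp).1)
  have := hcount.to_subtype
  have hpos : ∀ p ∈ T, 0 < ‖p.1‖ := fun p hp => by linarith [hp.1, hp.2.1]
  refine ⟨_, sv_eps (fun p : u => p.1.1) (fun p : u => 20 * p.1.2.1)
    (fun p => by have := (huT p.2).1; positivity) ?_ ?_, ?_⟩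
  · intro R
    have hex : ∀ p : u, ∃ a ∈ p.1.2.2, v a ≠ 0 := by
      intro p
      by_contra! h
      have := (huT p.2).2.2.2
      rw [Finset.sum_eq_zero h] at this
      linarith [(huT p.2).1]
    choose f hf hf' using hex
    have hfb : ∀ p : u, f p ∈ Metric.closedBall p.1.1 p.1.2.1 := fun p => by
      rw [mem_closedBall_iff_norm]; exact (huT p.2).2.2.1 _ (hf p)
    refine Set.Finite.of_finite_image (f := f) ((hfin (2 * R)).subset ?_) ?_
    · rintro _ ⟨p, hp, rfl⟩
      refine ⟨?_, hf' p⟩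
      have h1 := (huT p.2).2.2.1 _ (hf p)
      have h2 := (huT p.2).2.1
      have h3 : ‖p.1.1‖ ≤ R := hp
      have h4 := norm_add_le (f p - p.1.1) p.1.1
      rw [sub_add_cancel] at h4
      linarith [norm_nonneg p.1.1]
    · intro p _ q _ hpq
      by_contra hne
      have := hdisj p.2 q.2 (fun h => hne (Subtype.ext h))
      exact Set.disjoint_left.1 this (hfb p) (by rw [hpq]; exact hfb q)
  · refine summable_of_sum_le (c := 20 * ∑' a, v a) (fun p => by
      have := (huT p.2).1; dsimp; positivity) ?_
    intro F
    have h1 : ∑ p ∈ F, 20 * p.1.2.1 / ‖p.1.1‖ ≤ ∑ p ∈ F, 20 * ∑ a ∈ p.1.2.2, v a := by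
      apply Finset.sum_le_sum
      intro p _
      rw [div_le_iff₀ (hpos _ (huT p.2))]
      linarith [(huT p.2).2.2.2]
    refine h1.trans ?_
    rw [← Finset.mul_sum, ← Finset.sum_biUnion]
    · gcongr
      exact hs.sum_le_tsum _ (fun a _ => hv a)
    · intro p _ q _ hne
      have := hdisj p.2 q.2 (fun h => hne (Subtype.ext h))
      rw [Function.onFun, Finset.disjoint_left]
      intro a ha hb
      have h1 : a ∈ Metric.closedBall p.1.1 p.1.2.1 := by
        rw [mem_closedBall_iff_norm]; exact (huT p.2).2.2.1 _ ha
      have h2 : a ∈ Metric.closedBall q.1.1 q.1.2.1 := by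
        rw [mem_closedBall_iff_norm]; exact (huT q.2).2.2.1 _ hb
      exact Set.disjoint_left.1 this h1 h2
  · intro z hz t ht ht2 A hA
    by_contra! hcon
    have hT : (z, t, A) ∈ T := ⟨ht, ht2, hA, hcon⟩
    obtain ⟨q, hq, ⟨x, hx1, hx2⟩, hle⟩ := hcov _ hT
    apply hz
    rw [mem_iUnion]
    refine ⟨⟨q, hq⟩, ?_⟩
    have hz0 := hpos _ hT
    have hq0 := hpos _ (huT hq)
    have hqT := huT hq
    have h1 := hqT.1
    have h2 := hqT.2.1
    rw [mem_closedBall_iff_norm] at hx1 hx2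
    rw [mem_ball_iff_norm]
    dsimp only at hx1 hx2 hle hz0 ⊢
    have h3 : ‖z - q.1‖ ≤ t + q.2.1 := by
      have := norm_sub_le (x - q.1) (x - z)
      rw [sub_sub_sub_cancel_left] at this
      linarith
    have h4 : ‖z‖ ≤ 3 * ‖q.1‖ := by
      have := norm_add_le (z - q.1) q.1
      rw [sub_add_cancel] at this
      linarith
    have h5 : t ≤ 6 * q.2.1 := by
      rw [div_le_iff₀ hz0] at hle
      calc t ≤ 2 * (q.2.1 / ‖q.1‖) * ‖z‖ := hle
        _ ≤ 2 * (q.2.1 / ‖q.1‖) * (3 * ‖q.1‖) := by gcongr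
        _ = 6 * q.2.1 := by field_simp; ring
    linarith

open InnerProductSpace in
lemma sv_poisson {h : ℂ → ℝ} {R : ℝ} (hR : 0 < R)
    (hh : HarmonicOnNhd h (Metric.closedBall (0:ℂ) R)) {w : ℂ} (hw : ‖w‖ ≤ R / 2) :
    |h w| ≤ 3 * Real.circleAverage (fun z => |h z|) 0 R := by
  have hwb : w ∈ Metric.ball (0:ℂ) R := by simp; linarith
  have h1 := hh.circleAverage_re_herglotzRieszKernel_smul hwb
  have hcont : ContinuousOn h (Metric.sphere (0:ℂ) |R|) := by
    intro x hx
    rw [abs_of_pos hR] at hx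
    exact ((hh x (Metric.sphere_subset_closedBall hx)).1.continuousAt).continuousWithinAt
  rw [← h1]
  refine Real.abs_circleAverage_le_circleAverage_abs.trans ?_
  rw [← smul_eq_mul, ← Real.circleAverage_fun_smul]
  apply Real.circleAverage_mono
  · apply ContinuousOn.circleIntegrable'
    have hk := continuousOn_herglotzRieszKernel_sphere hwb
    have hk2 : ContinuousOn (Complex.re ∘ herglotzRieszKernel 0 w) (Metric.sphere (0:ℂ) |R|) :=
      Complex.continuous_re.comp_continuousOn hk
    exact (hk2.smul hcont).abs
  · apply ContinuousOn.circleIntegrable'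
    exact continuousOn_const.mul hcont.abs
  · intro z hz
    rw [abs_of_pos hR] at hz
    have u1 := re_herglotzRieszKernel_le hz hwb
    have u2 := le_re_herglotzRieszKernel hz hwb
    simp only [sub_zero] at u1 u2
    have hk : herglotzRieszKernel 0 w z = (z + w) / (z - w) := by
      simp [herglotzRieszKernel_def]
    have hn := norm_nonneg w
    have u3 : (R + ‖w‖) / (R - ‖w‖) ≤ 3 := by
      rw [div_le_iff₀ (by linarith)]; linarith
    have u4 : 0 ≤ (R - ‖w‖) / (R + ‖w‖) := div_nonneg (by linarith) (by linarith)
    simp only [Pi.mul_apply, Function.comp, hk, smul_eq_mul, abs_mul, Pi.abs_apply]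
    rw [abs_of_nonneg (u4.trans u2)]
    gcongr
    linarith

lemma sv_avg_log {R : ℝ} (hR : 1 ≤ R) {a : ℂ} (ha : ‖a‖ ≤ R) :
    CircleIntegrable (fun z => |Real.log ‖z - a‖|) 0 R ∧
    Real.circleAverage (fun z => |Real.log ‖z - a‖|) 0 R ≤ 2 * Real.log (2 * R) := by
  have hm : MeromorphicOn (fun z : ℂ => z - a) (Metric.sphere 0 |R|) :=
    (analyticOnNhd_id.sub analyticOnNhd_const).meromorphicOn
  have i1 := hm.circleIntegrable_log_norm
  refine ⟨i1.abs, ?_⟩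
  have e : (fun z : ℂ => |Real.log ‖z - a‖|) =
      fun z => (2:ℝ) • Real.posLog ‖z - a‖ - Real.log ‖z - a‖ := by
    ext z
    rw [← Real.half_mul_log_add_log_abs]; simp
  have i2 := hm.circleIntegrable_posLog_norm
  have e2 := Real.circleAverage_sub (CircleIntegrable.const_smul i2 (a := (2:ℝ))) i1
  have e3 : Real.circleAverage (fun z : ℂ => |Real.log ‖z - a‖|) 0 R =
      2 * Real.circleAverage (fun z => Real.posLog ‖z - a‖) 0 R
       - Real.circleAverage (fun z => Real.log ‖z - a‖) 0 R := by
    rw [e, ← smul_eq_mul, ← Real.circleAverage_smul]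
    exact e2
  rw [e3, circleAverage_log_norm_sub_const_eq_log_radius_add_posLog (by linarith)]
  have p1 : Real.circleAverage (fun z => Real.posLog ‖z - a‖) 0 R ≤ Real.log (2 * R) := by
    apply Real.circleAverage_mono_on_of_le_circle i2
    intro z hz
    rw [abs_of_pos (by linarith)] at hz
    simp at hz
    rw [← Real.posLog_eq_log (x := 2 * R) (by rw [abs_of_pos (by linarith)]; linarith)]
    apply Real.posLog_le_posLog (norm_nonneg _)
    linarith [norm_sub_le z a]
  have p2 : 0 ≤ Real.posLog (R⁻¹ * ‖0 - a‖) := Real.posLog_nonneg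
  have p3 := Real.log_nonneg hR
  linarith

open ValueDistribution MeromorphicOn in
lemma sv_factor (G : ℂ → ℂ) (hM : Meromorphic G) (hord : ∀ z, meromorphicOrderAt G z ≠ ⊤)
    (R : ℝ) (hR : 1 ≤ R) :
    ∃ (F : Finset ℂ) (g : ℂ → ℂ), (∀ a, a ∈ F ↔ ‖a‖ ≤ R ∧ divisor G univ a ≠ 0) ∧
      AnalyticOnNhd ℂ g (Metric.closedBall 0 R) ∧ (∀ u ∈ Metric.closedBall (0:ℂ) R, g u ≠ 0) ∧
      (∀ ζ ∈ Metric.ball (0:ℂ) R, ζ ∉ F → AnalyticAt ℂ G ζ →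
        G ζ = (∏ a ∈ F, (ζ - a) ^ (divisor G univ a)) * g ζ) ∧
      (∀ w : ℂ, ‖w‖ ≤ R / 2 → |Real.log ‖g w‖| ≤ 3 * (proximity G ⊤ R + proximity G⁻¹ ⊤ R +
        (∑ a ∈ F, (divisor G univ a).natAbs : ℕ) * (2 * Real.log (2 * R)))) := by
  classical
  have hR0 : 0 < R := by linarith
  have hMon : MeromorphicOn G (Metric.closedBall (0:ℂ) R) := fun z _ => hM z
  have hfin : (divisor G (Metric.closedBall (0:ℂ) R)).support.Finite :=
    (divisor G (Metric.closedBall (0:ℂ) R)).finiteSupport (isCompact_closedBall 0 R)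
  obtain ⟨g, hga, hg0, heq⟩ := hMon.extract_zeros_poles (fun u => hord u) hfin
  have hD : ∀ a, ‖a‖ ≤ R → divisor G (Metric.closedBall (0:ℂ) R) a = divisor G univ a := by
    intro a ha
    rw [divisor_apply hMon (by simpa using ha), divisor_apply (fun z _ => hM z) (mem_univ a)]
  have hD0 : ∀ a, ¬ ‖a‖ ≤ R → divisor G (Metric.closedBall (0:ℂ) R) a = 0 := by
    intro a ha
    exact Function.locallyFinsuppWithin.apply_eq_zero_of_notMem _ (by simpa using ha)
  set F := hfin.toFinset with hF
  have hFm : ∀ a, a ∈ F ↔ ‖a‖ ≤ R ∧ divisor G univ a ≠ 0 := by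
    intro a
    rw [hF, Set.Finite.mem_toFinset, Function.mem_support]
    by_cases ha : ‖a‖ ≤ R
    · simp [ha, hD a ha]
    · simp [ha, hD0 a ha]
  have hprod : (∏ᶠ u, (fun x : ℂ => x - u) ^ divisor G (Metric.closedBall (0:ℂ) R) u) =
      fun ζ => ∏ a ∈ F, (ζ - a) ^ (divisor G univ a) := by
    rw [finprod_eq_prod_of_mulSupport_subset (s := F)]
    · ext ζ
      simp only [Finset.prod_apply, Pi.pow_apply]
      apply Finset.prod_congr rfl
      intro a ha
      rw [hD a ((hFm a).1 ha).1]
    · intro a ha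
      rw [hF, Set.Finite.coe_toFinset, Function.mem_support]
      intro h0
      apply ha
      simp [h0]
  have heqlog := extract_zeros_poles_log hg0 heq
  have hsum : (∑ᶠ u, fun x : ℂ => (divisor G (Metric.closedBall (0:ℂ) R) u : ℝ) * Real.log ‖x - u‖) =
      fun ζ => ∑ a ∈ F, (divisor G univ a : ℝ) * Real.log ‖ζ - a‖ := by
    rw [finsum_eq_sum_of_support_subset (s := F)]
    · ext ζ
      simp only [Finset.sum_apply]
      apply Finset.sum_congr rfl
      intro a ha
      rw [hD a ((hFm a).1 ha).1]
    · intro a ha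
      rw [hF, Set.Finite.coe_toFinset, Function.mem_support]
      intro h0
      apply ha
      ext; simp [h0]
  rw [hprod] at heq
  rw [hsum] at heqlog
  refine ⟨F, g, hFm, hga, fun u hu => hg0 ⟨u, hu⟩, ?_, ?_⟩
  · intro ζ hζ hζF hGa
    have hζc := Metric.ball_subset_closedBall hζ
    have han : AnalyticAt ℂ (fun ζ => ∏ a ∈ F, (ζ - a) ^ (divisor G univ a)) ζ := by
      apply Finset.analyticAt_fun_prod
      intro a ha
      apply AnalyticAt.fun_zpow (by fun_prop)
      rw [sub_ne_zero]; rintro rfl; exact hζF ha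
    have hran : AnalyticAt ℂ ((fun ζ => ∏ a ∈ F, (ζ - a) ^ (divisor G univ a)) • g) ζ :=
      han.smul (hga ζ hζc)
    have hacc : AccPt ζ (𝓟 (Metric.closedBall (0:ℂ) R)) := by
      rw [accPt_iff_nhds]
      intro U hU
      have : (U ∩ Metric.ball (0:ℂ) R) ∈ 𝓝 ζ := inter_mem hU (Metric.isOpen_ball.mem_nhds hζ)
      obtain ⟨y, hy, hne⟩ := (NormedField.nhdsNE_neBot ζ).nonempty_of_mem
        (inter_mem (mem_nhdsWithin_of_mem_nhds this) self_mem_nhdsWithin)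
      exact ⟨y, ⟨hy.1, Metric.ball_subset_closedBall hy.2⟩, hne⟩
    have h1 := (hM ζ).eventuallyEq_nhdsNE_of_eventuallyEq_codiscreteWithin hran.meromorphicAt
      hζc hacc heq
    have h2 := (hGa.continuousAt.eventuallyEq_nhds_iff_eventuallyEq_nhdsNE hran.continuousAt).1 h1
    exact h2.eq_of_nhds
  · intro w hw
    have hharm : InnerProductSpace.HarmonicOnNhd (fun z => Real.log ‖g z‖)
        (Metric.closedBall (0:ℂ) R) := fun z hz => (hga z hz).harmonicAt_log_norm (hg0 ⟨z, hz⟩)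
    refine (sv_poisson hR0 hharm hw).trans ?_
    gcongr
    have hMs : MeromorphicOn G (Metric.sphere (0:ℂ) |R|) := fun z _ => hM z
    have hMi : MeromorphicOn G⁻¹ (Metric.sphere (0:ℂ) |R|) := hMs.inv
    have i1 := hMs.circleIntegrable_posLog_norm
    have i2 := hMi.circleIntegrable_posLog_norm
    have i3 : CircleIntegrable (fun z => ∑ a ∈ F, ((divisor G univ a).natAbs : ℝ) * |Real.log ‖z - a‖|) 0 R := by
      apply CircleIntegrable.fun_sum
      intro a ha
      exact (sv_avg_log hR ((hFm a).1 ha).1).1.const_mul _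
    have hle : Real.circleAverage (fun z => |Real.log ‖g z‖|) 0 R =
       Real.circleAverage (fun z => |Real.log ‖G z‖ -
          ∑ a ∈ F, (divisor G univ a : ℝ) * Real.log ‖z - a‖|) 0 R := by
      apply Real.circleAverage_congr_codiscreteWithin _ hR0.ne'
      rw [abs_of_pos hR0]
      have := heqlog.filter_mono (Filter.codiscreteWithin_mono Metric.sphere_subset_closedBall)
      filter_upwards [this] with z hz
      rw [hz]; simp
    rw [hle, proximity_top, proximity_top]
    calc _ ≤ Real.circleAverage (fun z => (Real.posLog ‖G z‖ + Real.posLog ‖G⁻¹ z‖) +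
        ∑ a ∈ F, ((divisor G univ a).natAbs : ℝ) * |Real.log ‖z - a‖|) 0 R := by
          apply Real.circleAverage_mono _ ((i1.add i2).add i3)
          · intro z hz
            refine (abs_sub _ _).trans ?_
            have a1 : |Real.log ‖G z‖| = Real.posLog ‖G z‖ + Real.posLog ‖G⁻¹ z‖ := by
              have := Real.half_mul_log_add_log_abs (x := ‖G z‖)
              have h' := Real.posLog_sub_posLog_inv (x := ‖G z‖)
              simp only [Pi.inv_apply, norm_inv]
              linarith
            rw [a1]
            refine add_le_add le_rfl ?_
            refine (Finset.abs_sum_le_sum_abs _ _).trans ?_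
            apply Finset.sum_le_sum
            intro a _
            rw [abs_mul, Nat.cast_natAbs, Int.cast_abs]
          · apply CircleIntegrable.abs
            apply CircleIntegrable.sub hMs.circleIntegrable_log_norm
            apply CircleIntegrable.fun_sum
            intro a ha
            have hm : MeromorphicOn (fun z : ℂ => z - a) (Metric.sphere 0 |R|) :=
              (analyticOnNhd_id.sub analyticOnNhd_const).meromorphicOn
            exact hm.circleIntegrable_log_norm.const_mul _
      _ = _ := Real.circleAverage_fun_add (i1.add i2) i3
      _ ≤ _ := by
        rw [Real.circleAverage_fun_add i1 i2]
        gcongr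
        have i4 : ∀ a ∈ F, CircleIntegrable (fun z => ((divisor G univ a).natAbs : ℝ) * |Real.log ‖z - a‖|) 0 R :=
          fun a ha => (sv_avg_log hR ((hFm a).1 ha).1).1.const_mul _
        rw [Real.circleAverage_fun_sum i4]
        push_cast
        rw [Finset.sum_mul]
        apply Finset.sum_le_sum
        intro a ha
        have := (sv_avg_log hR ((hFm a).1 ha).1).2
        simp_rw [← smul_eq_mul]
        rw [Real.circleAverage_fun_smul, smul_eq_mul, smul_eq_mul, smul_eq_mul, smul_eq_mul]
        gcongr

open MeromorphicOn in
lemma sv_mero {G : ℂ → ℂ} {P : Set ℂ} (h : TranscMeroPlane G P) :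
    Meromorphic G ∧ (∀ z, meromorphicOrderAt G z ≠ ⊤) ∧
      ∀ z, divisor G univ z = 0 → AnalyticAt ℂ G z := by
  obtain ⟨⟨hfin, han, hinf⟩, hrat⟩ := h
  have hP : ∀ p ∈ P, MeromorphicAt G p ∧ meromorphicOrderAt G p < 0 := by
    intro p hp
    have hev : ∀ᶠ z in 𝓝[≠] p, z ∉ P := by
      have h1 := hfin _ (isCompact_closedBall p 1)
      have h2 : ((P ∩ Metric.closedBall p 1) \ {p}).Finite := h1.subset sdiff_subset
      have h3 : ∀ᶠ z in 𝓝 p, z ∉ (P ∩ Metric.closedBall p 1) \ {p} :=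
        h2.isClosed.isOpen_compl.mem_nhds (by simp)
      have h4 : ∀ᶠ z in 𝓝 p, z ∈ Metric.closedBall p 1 := Metric.closedBall_mem_nhds p one_pos
      filter_upwards [mem_nhdsWithin_of_mem_nhds h3, mem_nhdsWithin_of_mem_nhds h4,
        self_mem_nhdsWithin] with z a b c d
      exact a ⟨⟨d, b⟩, c⟩
    have hle : 𝓝[≠] p ≤ 𝓝[Pᶜ] p := le_inf nhdsWithin_le_nhds (le_principal_iff.2 hev)
    have ht : Tendsto (fun z => ‖G z‖) (𝓝[≠] p) atTop := (hinf p hp).mono_left hle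
    have hne : ∀ᶠ z in 𝓝[≠] p, G z ≠ 0 := by
      filter_upwards [ht.eventually_gt_atTop 0] with z hz
      exact norm_pos_iff.1 hz
    have hcob : Tendsto G (𝓝[≠] p) (cobounded ℂ) := tendsto_norm_atTop_iff_cobounded.1 ht
    have hinv : Tendsto (fun z => (G z)⁻¹) (𝓝[≠] p) (𝓝 0) := tendsto_inv₀_cobounded.comp hcob
    have ha : AnalyticAt ℂ (Function.update (fun z => (G z)⁻¹) p 0) p := by
      apply Complex.analyticAt_of_differentiable_on_punctured_nhds_of_continuousAt
      · filter_upwards [hev, hne, self_mem_nhdsWithin] with z h1 h2 h3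
        have : DifferentiableAt ℂ (fun z => (G z)⁻¹) z := (han z h1).differentiableAt.inv h2
        apply this.congr_of_eventuallyEq
        filter_upwards [isOpen_ne.mem_nhds h3] with w hw
        exact Function.update_of_ne hw _ _
      · exact continuousAt_update_same.2 hinv
    have hm : MeromorphicAt (fun z => (G z)⁻¹) p := by
      apply ha.meromorphicAt.congr
      filter_upwards [self_mem_nhdsWithin] with z hz
      exact Function.update_of_ne hz _ _
    have hmG : MeromorphicAt G p := by
      refine hm.inv.congr (Eventually.of_forall fun z => ?_)
      simp
    exact ⟨hmG, (tendsto_cobounded_iff_meromorphicOrderAt_neg hmG).1 hcob⟩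
  have hM : Meromorphic G := by
    intro z
    by_cases hz : z ∈ P
    · exact (hP z hz).1
    · exact (han z hz).meromorphicAt
  refine ⟨hM, ?_, ?_⟩
  · by_contra hcon
    rw [← hM.exists_meromorphicOrderAt_ne_top_iff_forall] at hcon
    push Not at hcon
    apply hrat
    refine ⟨0, 1, one_ne_zero, ?_⟩
    intro z hz _
    have h1 := meromorphicOrderAt_eq_top_iff.1 (hcon z)
    have h2 : G =ᶠ[𝓝[≠] z] fun _ => 0 := h1
    have h3 := ((han z hz).continuousAt.eventuallyEq_nhds_iff_eventuallyEq_nhdsNE continuousAt_const).1 h2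
    simpa using h3.eq_of_nhds
  · intro z hz
    apply han
    intro hzP
    have h1 := (hP z hzP).2
    rw [divisor_apply (fun z _ => hM z) (mem_univ z)] at hz
    lift meromorphicOrderAt G z to ℤ using h1.ne_top with n hn
    simp at hz
    subst hz
    simp at h1

open MeromorphicOn in
lemma sv_poleOrder {G : ℂ → ℂ} (hM : Meromorphic G) (hord : ∀ z, meromorphicOrderAt G z ≠ ⊤)
    (z : ℂ) : (poleOrderAt G z : ℤ) = (divisor G univ)⁻ z := by
  have key : ∀ m : ℕ, PoleOrder G z m ↔ 0 < m ∧ meromorphicOrderAt G z = ((-(m:ℤ) : ℤ) : WithTop ℤ) := by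
    intro m
    rw [meromorphicOrderAt_eq_int_iff (hM z), PoleOrder]
    simp only [zpow_neg, zpow_natCast, smul_eq_mul, div_eq_mul_inv, mul_comm]
  rw [Function.locallyFinsuppWithin.negPart_apply, divisor_apply (fun z _ => hM z) (mem_univ z)]
  have h0 := hord z
  generalize hn' : meromorphicOrderAt G z = o at *
  lift o to ℤ using h0 with n hn
  simp only [WithTop.untop₀_coe]
  unfold poleOrderAt
  split_ifs with h
  · have h1 := (key _).1 h.choose_spec
    have h2 : n = -(h.choose : ℤ) := by exact_mod_cast h1.2
    rw [h2]; simp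
  · by_cases hn : n < 0
    · exfalso
      apply h
      refine ⟨n.natAbs, (key _).2 ⟨by omega, ?_⟩⟩
      congr 1; omega
    · simp [negPart_def]; omega

lemma sv_lc (D : Function.locallyFinsupp ℂ ℤ) (r : ℝ) (hr : 0 ≤ r) :
    ∃ F : Finset ℂ, (∀ a, a ∈ F ↔ ‖a‖ ≤ r ∧ D a ≠ 0) ∧
      Function.locallyFinsuppWithin.logCounting D r =
        ∑ a ∈ F, (D a : ℝ) * Real.log (r * ‖a‖⁻¹) + D 0 * Real.log r := by
  classical
  have hfin : (D.toClosedBall r).support.Finite :=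
    (D.toClosedBall r).finiteSupport (isCompact_closedBall 0 |r|)
  have hD : ∀ a, ‖a‖ ≤ r → D.toClosedBall r a = D a := by
    intro a ha
    exact Function.locallyFinsuppWithin.toClosedBall_eval_within D (by simpa [abs_of_nonneg hr] using ha)
  have hD0 : ∀ a, ¬ ‖a‖ ≤ r → D.toClosedBall r a = 0 := by
    intro a ha
    exact Function.locallyFinsuppWithin.apply_eq_zero_of_notMem _
      (by simpa [abs_of_nonneg hr] using ha)
  have hFm : ∀ a, a ∈ hfin.toFinset ↔ ‖a‖ ≤ r ∧ D a ≠ 0 := by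
    intro a
    rw [Set.Finite.mem_toFinset, Function.mem_support]
    by_cases ha : ‖a‖ ≤ r
    · simp [ha, hD a ha]
    · simp [ha, hD0 a ha]
  refine ⟨hfin.toFinset, hFm, ?_⟩
  have : Function.locallyFinsuppWithin.logCounting D r =
    ∑ᶠ z, (D.toClosedBall r z : ℝ) * Real.log (r * ‖z‖⁻¹) + (D 0) * Real.log r := rfl
  rw [this, finsum_eq_sum_of_support_subset (s := hfin.toFinset)]
  · congr 1
    apply Finset.sum_congr rfl
    intro a ha
    rw [hD a ((hFm a).1 ha).1]
  · intro a ha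
    rw [Set.Finite.coe_toFinset, Function.mem_support]
    intro h0
    apply ha
    simp [h0]

lemma sv_lc_lower (D : Function.locallyFinsupp ℂ ℤ) (hD : ∀ a, 0 ≤ D a) (R : ℝ) (hR : 1 ≤ R)
    (F' : Finset ℂ) (hF' : ∀ a ∈ F', ‖a‖ ≤ R) :
    (∑ a ∈ F', (D a : ℝ)) * Real.log 2 ≤ Function.locallyFinsuppWithin.logCounting D (2 * R) := by
  classical
  obtain ⟨F, hF, he⟩ := sv_lc D (2 * R) (by linarith)
  have hl2 : 0 < Real.log 2 := Real.log_pos (by norm_num)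
  have hDr : ∀ a, (0:ℝ) ≤ D a := fun a => by exact_mod_cast hD a
  have hterm : ∀ a ∈ F, 0 ≤ (D a : ℝ) * Real.log (2 * R * ‖a‖⁻¹) := by
    intro a ha
    apply mul_nonneg (hDr a)
    by_cases h0 : a = 0
    · simp [h0]
    · have : 0 < ‖a‖ := norm_pos_iff.2 h0
      apply Real.log_nonneg
      rw [← div_eq_mul_inv, one_le_div this]
      exact ((hF a).1 ha).1
  have hRl : Real.log 2 ≤ Real.log (2 * R) := Real.log_le_log (by norm_num) (by linarith)
  have h1 : (∑ a ∈ F', (D a : ℝ)) ≤ ∑ a ∈ F.filter (fun a => a ≠ 0 ∧ ‖a‖ ≤ R), (D a : ℝ) + D 0 := by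
    have s1 : (∑ a ∈ F', (D a : ℝ)) ≤ ∑ a ∈ insert 0 (F.filter (fun a => a ≠ 0 ∧ ‖a‖ ≤ R)), (D a : ℝ) := by
      rw [← Finset.sum_filter_ne_zero]
      apply Finset.sum_le_sum_of_subset_of_nonneg
      · intro a ha
        simp only [Finset.mem_filter, Finset.mem_insert] at ha ⊢
        by_cases h0 : a = 0
        · exact Or.inl h0
        · exact Or.inr ⟨(hF a).2 ⟨by linarith [hF' a ha.1], by exact_mod_cast ha.2⟩, h0, hF' a ha.1⟩
      · intro a _ _; exact hDr a
    rw [Finset.sum_insert (by simp)] at s1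
    linarith
  calc _ ≤ (∑ a ∈ F.filter (fun a => a ≠ 0 ∧ ‖a‖ ≤ R), (D a : ℝ) + D 0) * Real.log 2 := by gcongr
    _ = ∑ a ∈ F.filter (fun a => a ≠ 0 ∧ ‖a‖ ≤ R), (D a : ℝ) * Real.log 2 + D 0 * Real.log 2 := by
      rw [add_mul, Finset.sum_mul]
    _ ≤ ∑ a ∈ F.filter (fun a => a ≠ 0 ∧ ‖a‖ ≤ R), (D a : ℝ) * Real.log (2 * R * ‖a‖⁻¹) + D 0 * Real.log (2 * R) := by
      apply add_le_add
      · apply Finset.sum_le_sum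
        intro a ha
        simp only [Finset.mem_filter] at ha
        have : 0 < ‖a‖ := norm_pos_iff.2 ha.2.1
        apply mul_le_mul_of_nonneg_left _ (hDr a)
        apply Real.log_le_log (by norm_num)
        rw [← div_eq_mul_inv, le_div_iff₀ this]
        linarith [ha.2.2]
      · exact mul_le_mul_of_nonneg_left hRl (hDr 0)
    _ ≤ _ := by
      rw [he]
      gcongr
      · intro a ha _; exact hterm a ha
      · exact Finset.filter_subset _ _

lemma sv_int {c r : ℝ} (hc : 0 < c) (hcr : c ≤ r) :
    IntervalIntegrable (fun t : ℝ => (if c ≤ t then (1:ℝ) else 0) / t) volume 0 r ∧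
    ∫ t in (0:ℝ)..r, (if c ≤ t then (1:ℝ) else 0) / t = Real.log (r * c⁻¹) := by
  have e1 : ∀ᵐ t : ℝ, t ∈ uIoc 0 c → (0:ℝ) = (if c ≤ t then (1:ℝ) else 0) / t := by
    have : ∀ᵐ t : ℝ, t ≠ c := by simp [ae_iff]
    filter_upwards [this] with t ht h
    rw [uIoc_of_le hc.le] at h
    rw [if_neg (by intro h2; exact ht (le_antisymm h.2 h2))]; simp
  have e2 : ∀ t ∈ uIcc c r, (if c ≤ t then (1:ℝ) else 0) / t = t⁻¹ := by
    intro t ht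
    rw [uIcc_of_le hcr] at ht
    rw [if_pos ht.1, one_div]
  have i1 : IntervalIntegrable (fun t : ℝ => (if c ≤ t then (1:ℝ) else 0) / t) volume 0 c := by
    apply (intervalIntegrable_const (c := (0:ℝ))).congr_ae
    exact (ae_restrict_iff' measurableSet_uIoc).2 e1
  have i3 : IntervalIntegrable (fun t : ℝ => t⁻¹) volume c r := by
    rw [intervalIntegrable_inv_iff]
    right
    rw [uIcc_of_le hcr]; intro h; linarith [h.1]
  have i2 : IntervalIntegrable (fun t : ℝ => (if c ≤ t then (1:ℝ) else 0) / t) volume c r := by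
    apply i3.congr
    intro t ht
    exact (e2 t (uIoc_subset_uIcc ht)).symm
  refine ⟨i1.trans i2, ?_⟩
  rw [← intervalIntegral.integral_add_adjacent_intervals i1 i2,
    ← intervalIntegral.integral_congr_ae e1, intervalIntegral.integral_congr e2,
    integral_inv_of_pos hc (by linarith)]
  simp [div_eq_mul_inv]

open ValueDistribution MeromorphicOn in
lemma sv_nevN {G : ℂ → ℂ} (hM : Meromorphic G) (hord : ∀ z, meromorphicOrderAt G z ≠ ⊤)
    (r : ℝ) (hr : 1 ≤ r) : nevN G r = logCounting G ⊤ r := by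
  classical
  have hp := sv_poleOrder hM hord
  set D := (divisor G univ)⁻ with hDdef
  obtain ⟨F, hF, he⟩ := sv_lc D r (by linarith)
  have hpr : ∀ z, (poleOrderAt G z : ℝ) = D z := fun z => by exact_mod_cast hp z
  have hn : ∀ t ≤ r, (nCount G t : ℝ) = ∑ a ∈ F, (D a : ℝ) * (if ‖a‖ ≤ t then (1:ℝ) else 0) := by
    intro t ht
    unfold nCount
    rw [finsum_mem_eq_sum_of_inter_support_eq (t := F.filter (fun a => ‖a‖ ≤ t))]
    · push_cast
      rw [Finset.sum_filter]
      apply Finset.sum_congr rfl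
      intro a _
      rw [hpr]; simp
    · ext a
      simp only [mem_inter_iff, mem_ofPred_eq, Function.mem_support, Finset.coe_filter]
      have := hp a
      constructor
      · rintro ⟨h1, h2⟩
        exact ⟨⟨(hF a).2 ⟨h1.trans ht, by rw [← this]; exact_mod_cast h2⟩, h1⟩, h2⟩
      · rintro ⟨⟨_, h1⟩, h2⟩
        exact ⟨h1, h2⟩
  have hn0 : (nCount G 0 : ℝ) = D 0 := by
    rw [hn 0 (by linarith)]
    by_cases h0 : (0:ℂ) ∈ F
    · rw [Finset.sum_eq_single_of_mem 0 h0]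
      · simp
      · intro b _ hb; simp [hb]
    · have : D 0 = 0 := by
        by_contra hne; exact h0 ((hF 0).2 ⟨by simp; linarith, hne⟩)
      rw [this, Finset.sum_eq_zero]; · simp
      intro b hb
      have : b ≠ 0 := by rintro rfl; exact h0 hb
      simp [this]
  have hF0 : ∀ a ∈ F.filter (fun a => a ≠ 0), 0 < ‖a‖ ∧ ‖a‖ ≤ r := by
    intro a ha
    simp only [Finset.mem_filter] at ha
    exact ⟨norm_pos_iff.2 ha.2, ((hF a).1 ha.1).1⟩
  have hint : ∫ t in (0:ℝ)..r, ((nCount G t : ℝ) - (nCount G 0 : ℝ)) / t =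
      ∑ a ∈ F.filter (fun a => a ≠ 0), (D a : ℝ) * Real.log (r * ‖a‖⁻¹) := by
    have e1 : ∫ t in (0:ℝ)..r, ((nCount G t : ℝ) - (nCount G 0 : ℝ)) / t =
        ∫ t in (0:ℝ)..r, ∑ a ∈ F.filter (fun a => a ≠ 0),
          (D a : ℝ) * ((if ‖a‖ ≤ t then (1:ℝ) else 0) / t) := by
      apply intervalIntegral.integral_congr
      intro t ht
      rw [uIcc_of_le (by linarith)] at ht
      simp only
      rw [hn t ht.2, hn 0 (by linarith), ← Finset.sum_sub_distrib, Finset.sum_div, Finset.sum_filter]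
      apply Finset.sum_congr rfl
      intro a _
      by_cases h0 : a = 0
      · simp [h0, ht.1]
      · simp only [h0, norm_le_zero_iff, if_false, mul_zero, sub_zero, ne_eq, not_false_eq_true, if_true, mul_div_assoc]
    rw [e1, intervalIntegral.integral_finsetSum]
    · apply Finset.sum_congr rfl
      intro a ha
      rw [intervalIntegral.integral_const_mul, (sv_int (hF0 a ha).1 (hF0 a ha).2).2]
    · intro a ha
      exact (sv_int (hF0 a ha).1 (hF0 a ha).2).1.const_mul _
  have : ∑ a ∈ F.filter (fun a => a ≠ 0), (D a : ℝ) * Real.log (r * ‖a‖⁻¹) =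
      ∑ a ∈ F, (D a : ℝ) * Real.log (r * ‖a‖⁻¹) := by
    apply Finset.sum_filter_of_ne
    intro a _ h h0
    apply h; simp [h0]
  unfold nevN
  rw [hint, this, hn0, logCounting_top, he, add_comm]

open ValueDistribution MeromorphicOn in
lemma sv_nevm (G : ℂ → ℂ) (r : ℝ) : nevm G r = proximity G ⊤ r := by
  rw [proximity_top, Real.circleAverage_def, nevm]
  simp only [circleMap, zero_add, smul_eq_mul, one_div, Real.posLog_eq_log_max_one (norm_nonneg _)]

lemma sv_exp {G : ℂ → ℂ} {lam : ℝ} (hlam : 0 < lam) (h : growthOrder G < (lam : EReal)) :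
    ∃ s : ℝ, 0 < s ∧ s < lam ∧ ∀ᶠ r : ℝ in atTop, nevT G r ≤ r ^ s := by
  have h2 : max (growthOrder G) ((0:ℝ) : EReal) < (lam : EReal) :=
    max_lt h (by exact_mod_cast hlam)
  obtain ⟨s, hs1, hs2⟩ := EReal.lt_iff_exists_real_btwn.1 h2
  have h0 : (0:ℝ) < s := by exact_mod_cast (le_max_right _ _).trans_lt hs1
  refine ⟨s, h0, by exact_mod_cast hs2, ?_⟩
  have h3 := Filter.eventually_lt_of_limsup_lt ((le_max_left _ _).trans_lt hs1)
  filter_upwards [h3, eventually_gt_atTop 1] with r hr hr1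
  have hr' : Real.log (nevT G r) / Real.log r < s := by exact_mod_cast hr
  rw [div_lt_iff₀ (Real.log_pos hr1)] at hr'
  by_cases hT : 0 < nevT G r
  · rw [← Real.log_le_log_iff hT (by positivity), Real.log_rpow (by linarith)]
    exact hr'.le
  · exact (not_lt.1 hT).trans (by positivity)

lemma sv_const_le {C s₁ s : ℝ} (h : s₁ < s) : ∀ᶠ r : ℝ in atTop, C * r ^ s₁ ≤ r ^ s := by
  have h1 := tendsto_rpow_atTop (sub_pos.2 h)
  filter_upwards [h1.eventually_ge_atTop C, eventually_gt_atTop 0] with r hr h0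
  calc C * r ^ s₁ ≤ r ^ (s - s₁) * r ^ s₁ := by gcongr
    _ = r ^ s := by rw [← Real.rpow_add h0]; congr 1; ring

open ValueDistribution MeromorphicOn in
lemma sv_growth {G : ℂ → ℂ} {lam : ℝ} (hlam : 0 < lam) (h : growthOrder G < (lam : EReal))
    (hM : Meromorphic G) (hord : ∀ z, meromorphicOrderAt G z ≠ ⊤) :
    ∃ s R0 : ℝ, 0 < s ∧ s < lam ∧ ∀ R ≥ R0,
      (∀ F : Finset ℂ, (∀ a ∈ F, ‖a‖ ≤ R) →
        ((∑ a ∈ F, (divisor G univ a).natAbs : ℕ) : ℝ) ≤ R ^ s) ∧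
      proximity G ⊤ R + proximity G⁻¹ ⊤ R ≤ R ^ s := by
  obtain ⟨s₁, hs0, hs1, hT⟩ := sv_exp hlam h
  obtain ⟨s, hss, hsl⟩ := exists_between hs1
  set C := max |Real.log ‖G 0‖| |Real.log ‖meromorphicTrailingCoeffAt G 0‖| with hC
  have hC0 : 0 ≤ C := (abs_nonneg _).trans (le_max_left _ _)
  have hchar : ∀ r : ℝ, 1 ≤ r → nevT G r ≤ r ^ s₁ → characteristic G ⊤ r ≤ r ^ s₁ ∧
      characteristic G⁻¹ ⊤ r ≤ r ^ s₁ + C := by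
    intro r hr h1
    have e : nevT G r = characteristic G ⊤ r := by
      rw [nevT, sv_nevm, sv_nevN hM hord r hr]; rfl
    have h2 := (abs_le.1 (characteristic_sub_characteristic_inv_le hM (R := r))).1
    rw [← hC] at h2
    constructor
    · linarith
    · linarith
  have hch : ∀ (f : ℂ → ℂ) r, characteristic f ⊤ r = proximity f ⊤ r + logCounting f ⊤ r :=
    fun f r => rfl
  have ev : ∀ᶠ R : ℝ in atTop, 1 ≤ R ∧ nevT G R ≤ R ^ s₁ ∧ nevT G (2 * R) ≤ (2 * R) ^ s₁ ∧
      (2 + C) * R ^ s₁ ≤ R ^ s ∧ ((2 * 2 ^ s₁ + C) / Real.log 2) * R ^ s₁ ≤ R ^ s := by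
    refine (eventually_ge_atTop 1).and (hT.and (Eventually.and ?_ ((sv_const_le hss).and (sv_const_le hss))))
    exact (tendsto_id.const_mul_atTop (by norm_num : (0:ℝ) < 2)).eventually hT
  obtain ⟨R0, hR0⟩ := eventually_atTop.1 ev
  refine ⟨s, R0, hs0.trans hss, hsl, ?_⟩
  intro R hR
  obtain ⟨h1, h2, h3, h4, h5⟩ := hR0 R hR
  have hRs : 1 ≤ R ^ s₁ := Real.one_le_rpow h1 hs0.le
  constructor
  · intro F hF
    obtain ⟨c1, c2⟩ := hchar (2 * R) (by linarith) h3
    rw [hch] at c1 c2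
    have p1 : (0:ℝ) ≤ proximity G ⊤ (2 * R) := proximity_nonneg (f := G) (a := ⊤) (2 * R)
    have p2 : (0:ℝ) ≤ proximity G⁻¹ ⊤ (2 * R) := proximity_nonneg (f := G⁻¹) (a := ⊤) (2 * R)
    have p3 : C ≤ C * R ^ s₁ := le_mul_of_one_le_right hC0 hRs
    have l1 := sv_lc_lower (divisor G univ)⁻ (fun a => by simp) R h1 F hF
    have l2 := sv_lc_lower (divisor G univ)⁺ (fun a => by simp) R h1 F hF
    rw [← logCounting_top] at l1
    rw [← logCounting_zero, ← logCounting_inv] at l2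
    have e : ((∑ a ∈ F, (divisor G univ a).natAbs : ℕ) : ℝ) =
       (∑ a ∈ F, (((divisor G univ)⁺ a : ℤ) : ℝ)) + ∑ a ∈ F, (((divisor G univ)⁻ a : ℤ) : ℝ) := by
      rw [← Finset.sum_add_distrib]
      push_cast
      apply Finset.sum_congr rfl
      intro a _
      rw [Function.locallyFinsuppWithin.posPart_apply, Function.locallyFinsuppWithin.negPart_apply]
      rw [← Int.cast_add, posPart_add_negPart]
      simp
    rw [e]
    refine le_trans ?_ h5
    rw [div_mul_eq_mul_div, le_div_iff₀ (Real.log_pos (by norm_num))]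
    rw [Real.mul_rpow (by norm_num) (by linarith)] at c1 c2
    nlinarith
  · obtain ⟨c1, c2⟩ := hchar R h1 h2
    rw [hch] at c1 c2
    have p1 := logCounting_nonneg (f := G) (e := ⊤) h1
    have p2 := logCounting_nonneg (f := G⁻¹) (e := ⊤) h1
    nlinarith

lemma sv_borel {g : ℂ → ℂ} {z : ℂ} {r M : ℝ} (hr : 0 < r) (hM : 0 < M)
    (hg : DifferentiableOn ℂ g (Metric.ball z r)) (hg0 : ∀ w ∈ Metric.ball z r, g w ≠ 0)
    (hb : ∀ w ∈ Metric.ball z r, |Real.log ‖g w‖| ≤ M) {ζ : ℂ} (hζ : ‖ζ - z‖ ≤ r / 2) :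
    ∃ f : ℂ, g ζ = g z * Complex.exp f ∧ ‖f‖ ≤ 8 * M * ‖ζ - z‖ / r := by
  have hd : DifferentiableOn ℂ (fun w => deriv g w / g w) (Metric.ball z r) :=
    (hg.deriv Metric.isOpen_ball).div hg hg0
  obtain ⟨f, hf0, hf⟩ := hd.isExactOn_ball.with_val_at z 0
  have hz : z ∈ Metric.ball z r := Metric.mem_ball_self hr
  have hζb : ζ ∈ Metric.ball z r := by
    rw [Metric.mem_ball, dist_eq_norm]; linarith
  -- g * exp (-f) is constant
  have hconst : ∀ w ∈ Metric.ball z r, g w * Complex.exp (-f w) = g z * Complex.exp (-f z) := by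
    intro w hw
    have hder : ∀ x ∈ Metric.ball z r, HasDerivAt (fun w => g w * Complex.exp (-f w)) 0 x := by
      intro x hx
      have h1 : HasDerivAt g (deriv g x) x :=
        (hg.differentiableAt (Metric.isOpen_ball.mem_nhds hx)).hasDerivAt
      have h2 : HasDerivAt (fun w => g w * Complex.exp (-f w)) _ x := h1.mul ((hf x hx).neg.cexp)
      refine h2.congr_deriv ?_
      have h3 : g x * (deriv g x / g x) = deriv g x := mul_div_cancel₀ _ (hg0 x hx)
      linear_combination -Complex.exp (-f x) * h3
    apply (convex_ball z r).is_const_of_fderivWithin_eq_zero (𝕜 := ℂ)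
      (fun x hx => (hder x hx).differentiableAt.differentiableWithinAt) _ hw hz
    intro x hx
    rw [fderivWithin_of_isOpen Metric.isOpen_ball hx, (hder x hx).hasFDerivAt.fderiv]
    ext; simp
  have hexp : ∀ w ∈ Metric.ball z r, g w = g z * Complex.exp (f w) := by
    intro w hw
    have := hconst w hw
    rw [hf0, neg_zero, Complex.exp_zero, mul_one] at this
    rw [← this, mul_assoc, ← Complex.exp_add]; simp
  refine ⟨f ζ, hexp ζ hζb, ?_⟩
  have hbc := Complex.borelCaratheodory_zero (M := 2 * M) (R := r) (f := fun u => f (z + u)) (z := ζ - z)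
    (by linarith) (by
      intro u hu
      have : z + u ∈ Metric.ball z r := by simpa using hu
      exact ((hf _ this).differentiableAt.comp u (by fun_prop)).differentiableWithinAt) (by
      intro u hu
      have hu' : z + u ∈ Metric.ball z r := by simpa using hu
      have h1 := hexp _ hu'
      have h2 : Real.log ‖g (z + u)‖ = Real.log ‖g z‖ + (f (z + u)).re := by
        rw [h1, norm_mul, Real.log_mul (norm_ne_zero_iff.2 (hg0 z hz)) (by simp), Complex.norm_exp, Real.log_exp]
      have h3 := abs_le.1 (hb _ hu')
      have h4 := abs_le.1 (hb _ hz)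
      show (f (z + u)).re ≤ 2 * M
      linarith) hr (by simpa [dist_eq_norm] using hζb) (by simpa using hf0)
  simp only [add_sub_cancel] at hbc
  refine hbc.trans ?_
  have : 0 ≤ ‖ζ - z‖ := norm_nonneg _
  rw [div_le_div_iff₀ (by linarith) hr]
  nlinarith [mul_nonneg hM.le this]

lemma sv_prod (F : Finset ℂ) (D : ℂ → ℤ) {z ζ : ℂ} (h0 : ∀ a ∈ F, z ≠ a)
    (h : ∀ a ∈ F, ‖ζ - z‖ ≤ ‖z - a‖ / 2) :
    ∃ f : ℂ, ∏ a ∈ F, (ζ - a) ^ D a = (∏ a ∈ F, (z - a) ^ D a) * Complex.exp f ∧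
      ‖f‖ ≤ 3 / 2 * ‖ζ - z‖ * ∑ a ∈ F, ((D a).natAbs : ℝ) / ‖z - a‖ := by
  refine ⟨∑ a ∈ F, (D a : ℂ) * Complex.log (1 + (ζ - z) / (z - a)), ?_, ?_⟩
  · rw [Complex.exp_sum, ← Finset.prod_mul_distrib]
    apply Finset.prod_congr rfl
    intro a ha
    have hne : z - a ≠ 0 := sub_ne_zero.2 (h0 a ha)
    have hu : ‖(ζ - z) / (z - a)‖ ≤ 1 / 2 := by
      rw [norm_div, div_le_iff₀ (norm_pos_iff.2 hne)]
      linarith [h a ha]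
    have hne1 : 1 + (ζ - z) / (z - a) ≠ 0 := by
      intro h1
      have : (ζ - z) / (z - a) = -1 := by linear_combination h1
      rw [this] at hu; norm_num at hu
    rw [Complex.exp_int_mul, Complex.exp_log hne1, ← mul_zpow]
    congr 1
    field_simp; ring
  · refine (norm_sum_le _ _).trans ?_
    rw [Finset.mul_sum]
    apply Finset.sum_le_sum
    intro a ha
    have hne : z - a ≠ 0 := sub_ne_zero.2 (h0 a ha)
    have hu : ‖(ζ - z) / (z - a)‖ ≤ 1 / 2 := by
      rw [norm_div, div_le_iff₀ (norm_pos_iff.2 hne)]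
      linarith [h a ha]
    have := Complex.norm_log_one_add_half_le_self hu
    rw [norm_mul, Complex.norm_intCast, Nat.cast_natAbs, Int.cast_abs]
    calc |(D a : ℝ)| * _ ≤ |(D a : ℝ)| * (3 / 2 * ‖(ζ - z) / (z - a)‖) := by gcongr
      _ = _ := by rw [norm_div]; ring

lemma sv_close (m : ℂ → ℕ) (z : ℂ) (hz : 0 < ‖z‖) (K : ℝ) (hK : 0 < K) (F : Finset ℂ)
    (hm : ∀ a ∈ F, 1 ≤ m a)
    (H : ∀ t, 0 < t → t ≤ ‖z‖ / 2 → ∀ A ⊆ F, (∀ a ∈ A, ‖a - z‖ ≤ t) →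
      ((∑ a ∈ A, m a : ℕ) : ℝ) ≤ K * t) :
    (∀ a ∈ F, 1 / K ≤ ‖z - a‖ ∨ ‖z‖ / 2 ≤ ‖z - a‖) ∧
    ∑ a ∈ F, (m a : ℝ) / ‖z - a‖ ≤ K * (1 + Real.log (∑ a ∈ F, m a : ℕ)) +
      2 * (∑ a ∈ F, m a : ℕ) / ‖z‖ := by
  classical
  have h1 : ∀ a ∈ F, 1 / K ≤ ‖z - a‖ ∨ ‖z‖ / 2 ≤ ‖z - a‖ := by
    intro a ha
    by_contra! hcon
    obtain ⟨c1, c2⟩ := hcon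
    obtain ⟨t, ht1, ht2⟩ := exists_between (lt_min c1 c2)
    have ht0 : 0 < t := (norm_nonneg _).trans_lt ht1
    have := H t ht0 (ht2.le.trans (min_le_right _ _)) {a} (by simpa using ha)
      (by simp; rw [norm_sub_rev]; exact ht1.le)
    simp only [Finset.sum_singleton] at this
    have h2 : (1:ℝ) ≤ m a := by exact_mod_cast hm a ha
    have h3 : t < 1 / K := ht2.trans_le (min_le_left _ _)
    rw [lt_div_iff₀ hK] at h3
    linarith
  refine ⟨h1, ?_⟩
  set F1 := F.filter (fun a => ‖z - a‖ ≤ ‖z‖ / 2) with hF1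
  have hs := Finset.sum_filter_add_sum_filter_not F (fun a => ‖z - a‖ ≤ ‖z‖ / 2) (fun a => (m a : ℝ) / ‖z - a‖)
  rw [← hs]
  have hK1 : 0 < 1 / K := by positivity
  apply add_le_add
  · have hh := sv_harm m (fun a => ‖z - a‖) K hK F1 (by
      intro a ha
      rcases h1 a (Finset.mem_filter.1 ha).1 with h | h <;> linarith) (by
      intro F' hF' a ha hb
      have ha1 := Finset.mem_filter.1 (hF' ha)
      have hpos : 0 < ‖z - a‖ := by
        rcases h1 a ha1.1 with h | h <;> linarith
      apply H ‖z - a‖ hpos ha1.2 F' (hF'.trans (Finset.filter_subset _ _))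
      intro b hb'
      rw [norm_sub_rev]; exact hb b hb') (fun a ha => hm a (Finset.mem_filter.1 ha).1)
    refine hh.trans ?_
    have hle : (∑ b ∈ F1, m b) ≤ ∑ b ∈ F, m b :=
      Finset.sum_le_sum_of_subset (Finset.filter_subset _ _)
    refine mul_le_mul_of_nonneg_left (add_le_add le_rfl ?_) hK.le
    rcases Nat.eq_zero_or_pos (∑ b ∈ F1, m b) with h | h
    · rw [h]; simp only [Nat.cast_zero, Real.log_zero]; exact Real.log_natCast_nonneg _
    · apply Real.log_le_log (by exact_mod_cast h)
      exact_mod_cast hle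
  · calc _ ≤ ∑ a ∈ F with ¬ ‖z - a‖ ≤ ‖z‖ / 2, (m a : ℝ) * (2 / ‖z‖) := by
          apply Finset.sum_le_sum
          intro a ha
          have h2 := not_le.1 (Finset.mem_filter.1 ha).2
          rw [div_eq_mul_inv]
          gcongr
          rw [inv_le_comm₀ (by linarith) (by positivity), inv_div]
          exact h2.le
      _ ≤ ∑ a ∈ F, (m a : ℝ) * (2 / ‖z‖) := by
          apply Finset.sum_le_sum_of_subset_of_nonneg (Finset.filter_subset _ _)
          intro _ _ _; positivity
      _ = _ := by rw [← Finset.sum_mul]; push_cast; ring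

lemma sv_log_ev (C c σ τ : ℝ) (hc : 0 < c) (h : σ < τ) :
    ∀ᶠ r : ℝ in atTop, C * (1 + Real.log (c * r)) * r ^ σ ≤ r ^ τ := by
  obtain ⟨ρ, h1, h2⟩ := exists_between h
  have h3 := (isLittleO_log_rpow_atTop (sub_pos.2 h1)).bound one_pos
  filter_upwards [sv_const_le (C := |C| * (1 + |Real.log c| + 1)) h2, h3, eventually_ge_atTop 1] with r a b hr
  have hr0 : 0 < r := by linarith
  rw [Real.norm_eq_abs, Real.norm_eq_abs, one_mul, abs_of_nonneg (Real.log_nonneg hr),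
    abs_of_nonneg (by positivity)] at b
  have b1 : 1 ≤ r ^ (ρ - σ) := Real.one_le_rpow hr (by linarith)
  refine le_trans ?_ a
  have e : r ^ ρ = r ^ (ρ - σ) * r ^ σ := by rw [← Real.rpow_add hr0]; congr 1; ring
  rw [e, ← mul_assoc]
  gcongr ?_ * _
  rw [Real.log_mul hc.ne' hr0.ne']
  have hl := Real.log_nonneg hr
  calc C * (1 + (Real.log c + Real.log r)) ≤ |C * (1 + (Real.log c + Real.log r))| := le_abs_self _
    _ = |C| * |1 + (Real.log c + Real.log r)| := abs_mul _ _
    _ ≤ |C| * ((1 + |Real.log c| + 1) * r ^ (ρ - σ)) := by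
      gcongr
      rw [abs_le]
      have := abs_nonneg (Real.log c)
      have h5 := neg_abs_le (Real.log c)
      have h6 := le_abs_self (Real.log c)
      constructor <;> nlinarith
    _ = _ := by ring

open ValueDistribution MeromorphicOn in
set_option maxHeartbeats 2000000 in
lemma sv_local {G : ℂ → ℂ} {lam s s' s'' : ℝ} (hlam : 0 < lam) (hs : 0 < s) (hs'' : s'' < lam)
    (hM : Meromorphic G) (hord : ∀ z, meromorphicOrderAt G z ≠ ⊤)
    (han : ∀ z, divisor G univ z = 0 → AnalyticAt ℂ G z)
    {z : ℂ} {r : ℝ} (hzr : ‖z‖ = r) (hr4 : 4 ≤ r)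
    (hN : ∀ F : Finset ℂ, (∀ a ∈ F, ‖a‖ ≤ 8 * r) →
        ((∑ a ∈ F, (divisor G univ a).natAbs : ℕ) : ℝ) ≤ (8 * r) ^ s)
    (hprox : proximity G ⊤ (8 * r) + proximity G⁻¹ ⊤ (8 * r) ≤ (8 * r) ^ s)
    (H : ∀ t, 0 < t → t ≤ r / 2 → ∀ A : Finset ℂ, (∀ a ∈ A, ‖a - z‖ ≤ t) →
      ((∑ a ∈ A, (divisor G univ a).natAbs : ℕ) : ℝ) ≤ ((2 * r) ^ s' / r) * t)
    (e2 : 3 * ((8 * r) ^ s + (8 * r) ^ s * (2 * Real.log (16 * r))) + 1 ≤ r ^ s'')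
    (e3 : (2 * r) ^ s' * (1 + s * Real.log (8 * r)) ≤ r ^ s'')
    (e4 : (8 * r) ^ s * ((1 + lam) * Real.log (10 * r)) ≤ r ^ s'')
    (e5 : (8 * r) ^ s ≤ r ^ s'')
    (e6 : 4 ≤ r ^ lam) (e7 : 13 * r ^ s'' ≤ r ^ lam)
    {ζ : ℂ} (hζ : ‖ζ - z‖ ≤ r ^ (1 - lam)) :
    ‖G ζ / G z - 1‖ ≤ 2 * (13 * r ^ s'' / r ^ lam) ∧ |Real.log ‖G ζ‖| ≤ 2 * r ^ s'' := by
  have hr : 0 < r := by linarith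
  have hs0 : 0 < r ^ s'' := by positivity
  have hl0 : 0 < r ^ lam := by positivity
  have hrl : r ^ (1 - lam) = r / r ^ lam := by rw [Real.rpow_sub hr, Real.rpow_one]
  rw [hrl] at hζ
  obtain ⟨F, g, hF, hga, hg0, hfac, hlog⟩ := sv_factor G hM hord (8 * r) (by linarith)
  set D := divisor G univ with hD
  set K := (2 * r) ^ s' / r with hKdef
  have hK : 0 < K := by positivity
  set N := ∑ a ∈ F, (D a).natAbs with hNdef
  have hNle : (N : ℝ) ≤ (8 * r) ^ s := hN F (fun a ha => ((hF a).1 ha).1)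
  have hl8 : 0 ≤ Real.log (8 * r) := Real.log_nonneg (by linarith)
  have hlogN : Real.log N ≤ s * Real.log (8 * r) := by
    rcases Nat.eq_zero_or_pos N with h | h
    · rw [h]; simp; positivity
    · rw [← Real.log_rpow (by linarith)]
      exact Real.log_le_log (by exact_mod_cast h) hNle
  have hKle : K * (1 + s * Real.log (8 * r)) ≤ r ^ s'' / r := by
    rw [hKdef, div_mul_eq_mul_div]; gcongr
  have hKle' : K ≤ r ^ s'' / r := by
    refine le_trans ?_ hKle
    have : 0 ≤ s * Real.log (8 * r) := by positivity
    nlinarith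
  obtain ⟨hc1, hc2⟩ := sv_close (fun a => (D a).natAbs) z (by linarith) K hK F
    (fun a ha => by have := ((hF a).1 ha).2; omega)
    (by rw [hzr]; intro t h1 h2 A _ h3; exact H t h1 h2 A h3)
  rw [← hNdef, hzr] at hc2
  rw [hzr] at hc1
  have hζr : ‖ζ - z‖ ≤ r / 4 := hζ.trans (by gcongr)
  -- distance bounds
  have hinvK : r / r ^ s'' ≤ 1 / K := by
    rw [le_div_iff₀ hK]
    calc r / r ^ s'' * K ≤ r / r ^ s'' * (r ^ s'' / r) := by gcongr
      _ = 1 := by field_simp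
  have hdist : ∀ a ∈ F, ‖ζ - z‖ ≤ ‖z - a‖ / 2 := by
    intro a ha
    rcases hc1 a ha with h | h
    · have h1 : r / r ^ lam ≤ (r / r ^ s'') / 2 := by
        rw [div_div, div_le_div_iff_of_pos_left hr (by positivity) (by positivity)]
        linarith
      linarith
    · linarith
  have hpos : ∀ a ∈ F, 0 < ‖z - a‖ := by
    intro a ha
    have : 0 < r / r ^ s'' := by positivity
    rcases hc1 a ha with h | h <;> linarith
  have hne : ∀ a ∈ F, z ≠ a := by
    intro a ha h
    have := hpos a ha
    rw [h] at this; simp at this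
  have hζa : ∀ a ∈ F, ‖z - a‖ / 2 ≤ ‖ζ - a‖ := by
    intro a ha
    have h1 := hdist a ha
    have h2 : ‖z - a‖ ≤ ‖ζ - a‖ + ‖ζ - z‖ := by
      calc ‖z - a‖ = ‖(ζ - a) - (ζ - z)‖ := by congr 1; ring
        _ ≤ _ := norm_sub_le _ _
    linarith
  have hζn : ‖ζ‖ ≤ 2 * r := by
    calc ‖ζ‖ = ‖z + (ζ - z)‖ := by congr 1; ring
      _ ≤ ‖z‖ + ‖ζ - z‖ := norm_add_le _ _
      _ ≤ _ := by rw [hzr]; linarith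
  have hzF : z ∉ F := fun h => hne z h rfl
  have hζF : ζ ∉ F := by
    intro h
    have h1 := hζa ζ h
    have h2 := hpos ζ h
    simp at h1; linarith
  have hD0 : ∀ w : ℂ, ‖w‖ ≤ 2 * r → w ∉ F → D w = 0 := by
    intro w hw hwF
    by_contra h
    exact hwF ((hF w).2 ⟨by linarith, h⟩)
  have hball : ∀ w : ℂ, ‖w‖ ≤ 2 * r → w ∈ Metric.ball (0:ℂ) (8 * r) := by
    intro w hw; simp; linarith
  have hGz := hfac z (hball z (by linarith)) hzF (han z (hD0 z (by linarith) hzF))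
  have hGζ := hfac ζ (hball ζ hζn) hζF (han ζ (hD0 ζ hζn hζF))
  -- the bound for g
  set M := 3 * ((8 * r) ^ s + (8 * r) ^ s * (2 * Real.log (16 * r))) + 1 with hMdef
  have hl16 : 0 ≤ Real.log (16 * r) := Real.log_nonneg (by linarith)
  have hMpos : 0 < M := by positivity
  have hgM : ∀ w : ℂ, ‖w‖ ≤ 2 * r → |Real.log ‖g w‖| ≤ M - 1 := by
    intro w hw
    refine (hlog w (by linarith)).trans ?_
    have e : 2 * (8 * r) = 16 * r := by ring
    rw [e, hMdef]
    have : (N : ℝ) * (2 * Real.log (16 * r)) ≤ (8 * r) ^ s * (2 * Real.log (16 * r)) := by gcongr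
    linarith
  have hsub : ∀ w ∈ Metric.ball z r, ‖w‖ ≤ 2 * r := by
    intro w hw
    rw [Metric.mem_ball, dist_eq_norm] at hw
    calc ‖w‖ = ‖z + (w - z)‖ := by congr 1; ring
      _ ≤ ‖z‖ + ‖w - z‖ := norm_add_le _ _
      _ ≤ _ := by rw [hzr]; linarith
  have hcb : ∀ w : ℂ, ‖w‖ ≤ 2 * r → w ∈ Metric.closedBall (0:ℂ) (8 * r) :=
    fun w hw => Metric.ball_subset_closedBall (hball w hw)
  obtain ⟨f1, hf1, hf1b⟩ := sv_borel (g := g) (z := z) (ζ := ζ) hr hMpos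
    (fun w hw => (hga w (hcb w (hsub w hw))).differentiableAt.differentiableWithinAt)
    (fun w hw => hg0 w (hcb w (hsub w hw)))
    (fun w hw => (hgM w (hsub w hw)).trans (by linarith)) (by linarith)
  obtain ⟨f2, hf2, hf2b⟩ := sv_prod F D hne hdist
  have hg1 : g z ≠ 0 := hg0 z (hcb z (by linarith))
  have hp1 : ∏ a ∈ F, (z - a) ^ D a ≠ 0 :=
    Finset.prod_ne_zero_iff.2 fun a ha => zpow_ne_zero _ (sub_ne_zero.2 (hne a ha))
  constructor
  · have hq : G ζ / G z = Complex.exp (f1 + f2) := by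
      rw [hGζ, hGz, hf1, hf2, Complex.exp_add]
      field_simp
    have hb1 : ‖f1‖ ≤ 8 * r ^ s'' / r ^ lam := by
      refine hf1b.trans ?_
      calc 8 * M * ‖ζ - z‖ / r ≤ 8 * r ^ s'' * (r / r ^ lam) / r := by gcongr
        _ = _ := by field_simp
    have hb2 : ‖f2‖ ≤ 5 * r ^ s'' / r ^ lam := by
      refine hf2b.trans ?_
      have hS : ∑ a ∈ F, ((D a).natAbs : ℝ) / ‖z - a‖ ≤ 3 * r ^ s'' / r := by
        refine hc2.trans ?_
        have h1 : K * (1 + Real.log N) ≤ r ^ s'' / r := le_trans (by gcongr) hKle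
        have h2 : 2 * (N : ℝ) / r ≤ 2 * r ^ s'' / r := by
          gcongr; exact hNle.trans e5
        have h3 : 3 * r ^ s'' / r = r ^ s'' / r + 2 * r ^ s'' / r := by ring
        linarith
      calc 3 / 2 * ‖ζ - z‖ * _ ≤ 3 / 2 * (r / r ^ lam) * (3 * r ^ s'' / r) := by gcongr
        _ = 9 / 2 * (r ^ s'' / r ^ lam) := by field_simp; ring
        _ ≤ 5 * (r ^ s'' / r ^ lam) := by gcongr; norm_num
        _ = _ := by ring
    have hb : ‖f1 + f2‖ ≤ 13 * r ^ s'' / r ^ lam := by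
      refine (norm_add_le _ _).trans ?_
      have : 13 * r ^ s'' / r ^ lam = 8 * r ^ s'' / r ^ lam + 5 * r ^ s'' / r ^ lam := by ring
      linarith
    have hb1' : ‖f1 + f2‖ ≤ 1 := hb.trans (by rw [div_le_one hl0]; exact e7)
    rw [hq]
    exact (Complex.norm_exp_sub_one_le hb1').trans (by gcongr)
  · have hl10 : 0 ≤ Real.log (10 * r) := Real.log_nonneg (by linarith)
    have hlogG : Real.log ‖G ζ‖ = ∑ a ∈ F, (D a : ℝ) * Real.log ‖ζ - a‖ + Real.log ‖g ζ‖ := by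
      have hne' : ∀ a ∈ F, ‖(ζ - a) ^ D a‖ ≠ 0 := fun a ha =>
        norm_ne_zero_iff.2 (zpow_ne_zero _ (norm_pos_iff.1 (by linarith [hζa a ha, hpos a ha])))
      rw [hGζ, norm_mul, norm_prod, Real.log_mul (Finset.prod_ne_zero_iff.2 hne')
        (norm_ne_zero_iff.2 (hg0 ζ (hcb ζ hζn))), Real.log_prod hne']
      congr 1
      apply Finset.sum_congr rfl
      intro a _
      rw [norm_zpow, Real.log_zpow]
    have hterm : ∀ a ∈ F, |Real.log ‖ζ - a‖| ≤ (1 + lam) * Real.log (10 * r) := by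
      intro a ha
      have hp : 0 < ‖ζ - a‖ := by linarith [hζa a ha, hpos a ha]
      have hup : ‖ζ - a‖ ≤ 10 * r := by
        have := norm_sub_le ζ a
        linarith [((hF a).1 ha).1]
      rw [abs_le]
      constructor
      · have hlow : (10 * r) ^ (-(1 + lam)) ≤ ‖ζ - a‖ := by
          have h1 : (10 * r) ^ (-(1 + lam)) ≤ r / r ^ lam / 10 := by
            have : (10 * r) ^ (-(1 + lam)) ≤ r ^ (-(1 + lam)) / 10 := by
              rw [Real.rpow_neg (by linarith), Real.rpow_neg hr.le, Real.mul_rpow (by norm_num) hr.le,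
                Real.rpow_add (by norm_num : (0:ℝ) < 10), Real.rpow_one, mul_inv, mul_inv, div_eq_mul_inv]
              have h10 : ((10:ℝ) ^ lam)⁻¹ ≤ 1 := inv_le_one_of_one_le₀ (Real.one_le_rpow (by norm_num) hlam.le)
              have hrr : 0 < (r ^ (1 + lam))⁻¹ := by positivity
              nlinarith
            refine this.trans ?_
            gcongr
            rw [← hrl]
            apply Real.rpow_le_rpow_of_exponent_le (by linarith)
            linarith
          have h2 : r / r ^ lam / 10 ≤ ‖z - a‖ / 2 := by
            have h0 : 0 < r / r ^ lam := by positivity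
            rcases hc1 a ha with h | h
            · have h1 : r / r ^ lam ≤ (r / r ^ s'') := by
                rw [div_le_div_iff_of_pos_left hr (by positivity) (by positivity)]
                linarith
              linarith
            · have h1 : r / r ^ lam ≤ r / 4 := by gcongr
              linarith
          linarith [hζa a ha]
        have := Real.log_le_log (by positivity) hlow
        rw [Real.log_rpow (by linarith)] at this
        linarith
      · have := Real.log_le_log hp hup
        nlinarith
    rw [hlogG]
    refine (abs_add_le _ _).trans ?_
    have h1 : |∑ a ∈ F, (D a : ℝ) * Real.log ‖ζ - a‖| ≤ r ^ s'' := by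
      refine le_trans ?_ e4
      calc |∑ a ∈ F, (D a : ℝ) * Real.log ‖ζ - a‖| ≤ ∑ a ∈ F, |(D a : ℝ) * Real.log ‖ζ - a‖| :=
            Finset.abs_sum_le_sum_abs _ _
        _ ≤ ∑ a ∈ F, ((D a).natAbs : ℝ) * ((1 + lam) * Real.log (10 * r)) := by
            apply Finset.sum_le_sum
            intro a ha
            rw [abs_mul, Nat.cast_natAbs, Int.cast_abs]
            gcongr
            exact hterm a ha
        _ = N * ((1 + lam) * Real.log (10 * r)) := by
            rw [← Finset.sum_mul, hNdef]; push_cast; rfl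
        _ ≤ _ := by gcongr
    have h2 := hgM ζ hζn
    linarith

/-- Lemma 7.2: if `G` is transcendental meromorphic of order less than `λ`,
there is an ε-set `E` such that, as `z → ∞` off `E`, uniformly for `|ζ - z| ≤ |z|^{1-λ}`,
`G(ζ) ∼ G(z)` and `|log |G(ζ)|| = o(|z|^λ)`. -/
theorem slow_variation_off_epsilon_set
    (lam : ℝ) (hlam : 0 < lam)
    (G : ℂ → ℂ) (PG : Set ℂ)
    (hG : TranscMeroPlane G PG)
    (hord : growthOrder G < (lam : EReal)) :
    ∃ E : Set ℂ, IsEpsilonSet E ∧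
      ∀ ε : ℝ, 0 < ε → ∃ r₀ : ℝ, ∀ z : ℂ, z ∉ E → r₀ ≤ ‖z‖ →
        ∀ ζ : ℂ, ‖ζ - z‖ ≤ ‖z‖ ^ (1 - lam) →
          ‖G ζ / G z - 1‖ ≤ ε ∧
          |Real.log (‖G ζ‖)| ≤ ε * ‖z‖ ^ lam := by
  obtain ⟨hM, hordt, han⟩ := sv_mero hG
  obtain ⟨s, R0, hs0, hsl, hgr⟩ := sv_growth hlam hord hM hordt
  obtain ⟨s', hss', hs'l⟩ := exists_between hsl
  obtain ⟨s'', hs's'', hs''l⟩ := exists_between hs'l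
  set m : ℂ → ℕ := fun a => (MeromorphicOn.divisor G univ a).natAbs with hm
  have hsum := sv_summable m s s' R0 hs0 hss' (fun R hR => (hgr R hR).1)
  obtain ⟨E, hE, hgood⟩ := sv_vitali (fun a => (m a : ℝ) * ‖a‖ ^ (-s')) (fun a => by positivity) hsum (by
    intro R
    obtain ⟨F, hF, _⟩ := sv_lc (MeromorphicOn.divisor G univ) (max R 0) (le_max_right _ _)
    apply F.finite_toSet.subset
    rintro a ⟨h1, h2⟩
    refine (hF a).2 ⟨h1.trans (le_max_left _ _), ?_⟩
    intro h3
    apply h2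
    simp [hm, h3])
  refine ⟨E, hE, ?_⟩
  intro ε hε
  have ev : ∀ᶠ r : ℝ in atTop, 4 ≤ r ∧ R0 ≤ 8 * r ∧
      3 * ((8 * r) ^ s + (8 * r) ^ s * (2 * Real.log (16 * r))) + 1 ≤ r ^ s'' ∧
      (2 * r) ^ s' * (1 + s * Real.log (8 * r)) ≤ r ^ s'' ∧
      (8 * r) ^ s * ((1 + lam) * Real.log (10 * r)) ≤ r ^ s'' ∧
      (8 * r) ^ s ≤ r ^ s'' ∧ 4 ≤ r ^ lam ∧ 13 * r ^ s'' ≤ r ^ lam ∧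
      (26 / ε) * r ^ s'' ≤ r ^ lam := by
    have hss'' : s < s'' := hss'.trans hs's''
    filter_upwards [eventually_ge_atTop 4, eventually_ge_atTop (R0 / 8),
      sv_log_ev (6 * 8 ^ s + 1) 16 s s'' (by norm_num) hss'',
      sv_log_ev (2 ^ s' * (1 + s)) 8 s' s'' (by norm_num) hs's'',
      sv_log_ev (8 ^ s * (1 + lam)) 10 s s'' (by norm_num) hss'',
      sv_const_le (C := 8 ^ s) hss'', (tendsto_rpow_atTop hlam).eventually_ge_atTop 4,
      sv_const_le (C := 13) hs''l, sv_const_le (C := 26 / ε) hs''l] with r a1 a2 a3 a4 a5 a6 a7 a8 a9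
    have hr : 0 < r := by linarith
    have l8 : 0 ≤ Real.log (8 * r) := Real.log_nonneg (by linarith)
    have l10 : 0 ≤ Real.log (10 * r) := Real.log_nonneg (by linarith)
    have l16 : 0 ≤ Real.log (16 * r) := Real.log_nonneg (by linarith)
    have p1 : 1 ≤ r ^ s := Real.one_le_rpow (by linarith) hs0.le
    have p8 : (0:ℝ) < 8 ^ s := by positivity
    have p2 : (0:ℝ) < 2 ^ s' := by positivity
    have pr : 0 < r ^ s' := by positivity
    rw [Real.mul_rpow (by norm_num) hr.le, Real.mul_rpow (by norm_num) hr.le]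
    refine ⟨a1, by linarith, le_trans ?_ a3, le_trans ?_ a4, le_trans ?_ a5, a6, a7, a8, a9⟩
    · have q : 0 ≤ 8 ^ s * r ^ s := by positivity
      have q2 : 0 ≤ Real.log (16 * r) * r ^ s := by positivity
      nlinarith
    · have : 1 + s * Real.log (8 * r) ≤ (1 + s) * (1 + Real.log (8 * r)) := by nlinarith
      calc 2 ^ s' * r ^ s' * (1 + s * Real.log (8 * r))
          ≤ 2 ^ s' * r ^ s' * ((1 + s) * (1 + Real.log (8 * r))) := by gcongr
        _ = _ := by ring
    · calc 8 ^ s * r ^ s * ((1 + lam) * Real.log (10 * r))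
          ≤ 8 ^ s * r ^ s * ((1 + lam) * (1 + Real.log (10 * r))) := by gcongr; linarith
        _ = _ := by ring
  obtain ⟨r₀, hr₀⟩ := eventually_atTop.1 ev
  refine ⟨r₀, ?_⟩
  intro z hzE hzr ζ hζ
  obtain ⟨b1, b2, b3, b4, b5, b6, b7, b8, b9⟩ := hr₀ ‖z‖ hzr
  have hr : 0 < ‖z‖ := by linarith
  have hloc := sv_local (s' := s') hlam hs0 hs''l hM hordt han rfl b1 (hgr _ b2).1 (hgr _ b2).2 (by
    intro t ht htr A hA
    have h1 := hgood z hzE t ht htr A hA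
    have h2 : ‖z‖ * ((∑ a ∈ A, (m a : ℝ)) * (2 * ‖z‖) ^ (-s')) ≤ ‖z‖ * ∑ a ∈ A, (m a : ℝ) * ‖a‖ ^ (-s') := by
      apply mul_le_mul_of_nonneg_left _ hr.le
      rw [Finset.sum_mul]
      apply Finset.sum_le_sum
      intro a ha
      apply mul_le_mul_of_nonneg_left _ (by positivity)
      have h3 := hA a ha
      have h4 : ‖z‖ ≤ ‖a‖ + ‖a - z‖ := by
        calc ‖z‖ = ‖a - (a - z)‖ := by congr 1; ring
          _ ≤ _ := norm_sub_le _ _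
      have h5 : ‖a‖ ≤ ‖z‖ + ‖a - z‖ := by
        calc ‖a‖ = ‖z + (a - z)‖ := by congr 1; ring
          _ ≤ _ := norm_add_le _ _
      exact Real.rpow_le_rpow_of_nonpos (by linarith) (by linarith) (by linarith)
    have h3 := h2.trans h1.le
    rw [Real.rpow_neg (by positivity)] at h3
    have hp : 0 < (2 * ‖z‖) ^ s' := by positivity
    push_cast
    rw [div_mul_eq_mul_div, le_div_iff₀ hr]
    have h4 : ‖z‖ * ∑ a ∈ A, (m a : ℝ) ≤ t * (2 * ‖z‖) ^ s' := by
      rw [← div_le_iff₀ hp]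
      refine le_trans (le_of_eq ?_) h3
      rw [div_eq_mul_inv]; ring
    have h5 : ∑ a ∈ A, (m a : ℝ) = ∑ a ∈ A, |((MeromorphicOn.divisor G univ a : ℤ) : ℝ)| := by
      apply Finset.sum_congr rfl
      intro a _
      simp [hm]
    first
      | linarith
      | (rw [h5] at h4; linarith)) b3 b4 b5 b6 b7 b8 hζ
  have hl0 : 0 < ‖z‖ ^ lam := by positivity
  have hs0' : 0 < ‖z‖ ^ s'' := by positivity
  have b10 : 26 * ‖z‖ ^ s'' ≤ ε * ‖z‖ ^ lam := by
    rw [div_mul_eq_mul_div, div_le_iff₀ hε] at b9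
    linarith
  refine ⟨hloc.1.trans ?_, hloc.2.trans (by linarith)⟩
  rw [← mul_div_assoc, div_le_iff₀ hl0]
  linarith

end
end
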